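/- arXiv:2502.11666 — 8 statements merged into one kernel-verified Lean document; each statement's English description precedes it below -/
import Mathlib

section
/- Let q be an even prime power with q ≥ 162019556021. Then for every integer s with 1 ≤ s ≤ 7 and every δ ∈ F_{q^8} ∖ {0}, the binomial f(x) = x^{q^s} + δ x^{q^{(s+4) mod 8}} is not scattered over F_{q^8}. -/
/-- An `F_q`-linearized map `f` on a field `F` (of size `q ^ n`) is *scattered* if for all
nonzero `x, y`, `f x / x = f y / y` implies that `x / y` lies in the subfield `F_q`,
identified with the set of fixed points of `z ↦ z ^ q`. -/
def IsScattered (q : ℕ) {F : Type*} [Field F] (f : F → F) : Prop :=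
  ∀ x y : F, x ≠ 0 → y ≠ 0 → f x / x = f y / y → (x / y) ^ q = x / y

open Finset Polynomial

/-- If the `n`-th iterate of an additive endomorphism of a finite group vanishes, the kernel is
large. -/
theorem card_le_card_ker_pow {K : Type*} [AddCommGroup K] [Fintype K] [DecidableEq K]
    (m : K →+ K) (n : ℕ) (h : ∀ x, m^[n] x = 0) :
    Fintype.card K ≤ #{x | m x = 0} ^ n := by
  have key : ∀ n : ℕ, #{x | m^[n] x = 0} ≤ #{x | m x = 0} ^ n := by
    intro n
    induction n with
    | zero =>
      refine Finset.card_le_one.2 fun a ha b hb => ?_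
      have ha' := (Finset.mem_filter.1 ha).2
      have hb' := (Finset.mem_filter.1 hb).2
      exact ha'.trans hb'.symm
    | succ n ih =>
      have h1 := Finset.card_le_mul_card_image (f := m^[n]) ({x | m^[n + 1] x = 0} : Finset K)
        (#{x | m^[n] x = 0}) (by
          intro b hb
          obtain ⟨x₀, -, hx₀⟩ := Finset.mem_image.1 hb
          refine Finset.card_le_card_of_injOn (fun x => x - x₀) ?_ ?_
          · intro x hx
            have := (Finset.mem_filter.1 hx).2
            simp [iterate_map_sub, this, hx₀]
          · intro x _ y _ hxy
            simpa using hxy)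
      refine h1.trans ?_
      rw [pow_succ]
      refine Nat.mul_le_mul ih (Finset.card_le_card ?_)
      intro y hy
      obtain ⟨x, hx, rfl⟩ := Finset.mem_image.1 hy
      have := (Finset.mem_filter.1 hx).2
      rw [Function.iterate_succ_apply'] at this
      simpa using this
  have := key n
  simpa [h] using this

theorem card_pow_eq_self_le {K : Type*} [Field K] [Fintype K] [DecidableEq K] {q : ℕ}
    (hq : 1 < q) : #{x : K | x ^ q = x} ≤ q := by
  have hne := FiniteField.X_pow_card_sub_X_ne_zero K hq
  have h := Polynomial.card_le_degree_of_subset_roots (p := (X ^ q - X : K[X]))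
    (Z := {x : K | x ^ q = x}) (by
      intro x hx
      have hx' : x ^ q = x := by simpa using hx
      rw [Polynomial.mem_roots hne]
      simp [hx'])
  rwa [FiniteField.X_pow_card_sub_X_natDegree_eq K hq] at h

/-- The additive map `x ↦ σ x + x`. -/
def addSelfHom {K : Type*} [Field K] (σ : K →+* K) : K →+ K :=
  σ.toAddMonoidHom + AddMonoidHom.id K

theorem addSelfHom_apply {K : Type*} [Field K] (σ : K →+* K) (x : K) :
    addSelfHom σ x = σ x + x := rfl

theorem addSelfHom_eq_zero {K : Type*} [Field K] [CharP K 2] (σ : K →+* K) (x : K) :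
    addSelfHom σ x = 0 ↔ σ x = x := by
  rw [addSelfHom_apply, CharTwo.add_eq_zero]

theorem le_card_fixed {K : Type*} [Field K] [Fintype K] [DecidableEq K] [CharP K 2]
    {q : ℕ} (hcard : Fintype.card K = q ^ 8) (σ : K →+* K)
    (h8 : ∀ x, σ (σ (σ (σ (σ (σ (σ (σ x))))))) = x) :
    q ≤ #{x | σ x = x} := by
  have h := card_le_card_ker_pow (addSelfHom σ) 8 (by
    intro x
    have h2 : (2 : K) = 0 := CharTwo.two_eq_zero
    have e2 : ∀ x, addSelfHom σ (addSelfHom σ x) = σ (σ x) + x := by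
      intro x
      simp only [addSelfHom_apply, map_add]
      linear_combination σ x * h2
    have e4 : ∀ x, addSelfHom σ (addSelfHom σ (addSelfHom σ (addSelfHom σ x))) =
        σ (σ (σ (σ x))) + x := by
      intro x
      simp only [e2, map_add]
      linear_combination σ (σ x) * h2
    simp only [Function.iterate_succ, Function.iterate_zero, Function.comp_apply, id_eq]
    rw [e4, e4]
    simp only [map_add, h8]
    linear_combination (x + σ (σ (σ (σ x)))) * h2)
  simp only [addSelfHom_eq_zero] at h
  rw [hcard] at h
  exact (Nat.pow_le_pow_iff_left (by norm_num)).1 h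

theorem exists_trace_eq_one {K : Type*} [Field K] [Fintype K] [CharP K 2]
    {q : ℕ} (hq : 1 < q) (hcard : Fintype.card K = q ^ 8) (σ : K →+* K)
    (h8 : ∀ x, σ (σ (σ (σ (σ (σ (σ (σ x))))))) = x) (hfix : ∀ x, σ x = x ↔ x ^ q = x) :
    ∃ β : K, β + σ β + σ (σ β) + σ (σ (σ β)) + σ (σ (σ (σ β))) + σ (σ (σ (σ (σ β)))) +
      σ (σ (σ (σ (σ (σ β))))) + σ (σ (σ (σ (σ (σ (σ β)))))) = 1 := by
  classical
  have h2 : (2 : K) = 0 := CharTwo.two_eq_zero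
  set Tr : K → K := fun β => β + σ β + σ (σ β) + σ (σ (σ β)) + σ (σ (σ (σ β))) +
    σ (σ (σ (σ (σ β)))) + σ (σ (σ (σ (σ (σ β))))) + σ (σ (σ (σ (σ (σ (σ β)))))) with hTr
  by_cases hall : ∀ x, Tr x = 0
  · exfalso
    have h := card_le_card_ker_pow (addSelfHom σ) 7 (by
      intro x
      have e2 : ∀ x, addSelfHom σ (addSelfHom σ x) = σ (σ x) + x := by
        intro x
        simp only [addSelfHom_apply, map_add]
        linear_combination σ x * h2
      have e4 : ∀ x, addSelfHom σ (addSelfHom σ (addSelfHom σ (addSelfHom σ x))) =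
          σ (σ (σ (σ x))) + x := by
        intro x
        simp only [e2, map_add]
        linear_combination σ (σ x) * h2
      simp only [Function.iterate_succ, Function.iterate_zero, Function.comp_apply, id_eq]
      rw [e4, e2, addSelfHom_apply]
      simp only [map_add]
      rw [← hall x, hTr]
      ring)
    simp only [addSelfHom_eq_zero, hfix] at h
    rw [hcard] at h
    have h3 := h.trans (Nat.pow_le_pow_left (card_pow_eq_self_le hq) 7)
    have := Nat.pow_lt_pow_right hq (show 7 < 8 by norm_num)
    omega
  · push Not at hall
    obtain ⟨x, hx⟩ := hall
    have hfx : σ (Tr x) = Tr x := by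
      simp only [hTr, map_add, h8]
      ring
    refine ⟨(Tr x)⁻¹ * x, ?_⟩
    have : Tr ((Tr x)⁻¹ * x) = (Tr x)⁻¹ * Tr x := by
      simp only [hTr] at hfx ⊢
      simp only [map_mul, map_inv₀, hfx]
      ring
    rw [inv_mul_cancel₀ hx] at this
    exact this

/-- Additive Hilbert 90 for an automorphism of order dividing `8`. -/
theorem exists_map_add_self_eq {K : Type*} [Field K] [CharP K 2] (σ : K →+* K)
    (h8 : ∀ x, σ (σ (σ (σ (σ (σ (σ (σ x))))))) = x) {β : K}
    (hβ : β + σ β + σ (σ β) + σ (σ (σ β)) + σ (σ (σ (σ β))) + σ (σ (σ (σ (σ β)))) +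
      σ (σ (σ (σ (σ (σ β))))) + σ (σ (σ (σ (σ (σ (σ β)))))) = 1) (e : K)
    (he : e + σ e + σ (σ e) + σ (σ (σ e)) + σ (σ (σ (σ e))) + σ (σ (σ (σ (σ e)))) +
      σ (σ (σ (σ (σ (σ e))))) + σ (σ (σ (σ (σ (σ (σ e)))))) = 0) :
    ∃ Z, σ Z + Z = e := by
  refine ⟨e * σ β + (e + σ e) * σ (σ β) + (e + σ e + σ (σ e)) * σ (σ (σ β)) +
    (e + σ e + σ (σ e) + σ (σ (σ e))) * σ (σ (σ (σ β))) +
    (e + σ e + σ (σ e) + σ (σ (σ e)) + σ (σ (σ (σ e)))) * σ (σ (σ (σ (σ β)))) +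
    (e + σ e + σ (σ e) + σ (σ (σ e)) + σ (σ (σ (σ e))) + σ (σ (σ (σ (σ e))))) *
      σ (σ (σ (σ (σ (σ β))))) +
    (e + σ e + σ (σ e) + σ (σ (σ e)) + σ (σ (σ (σ e))) + σ (σ (σ (σ (σ e)))) +
      σ (σ (σ (σ (σ (σ e)))))) * σ (σ (σ (σ (σ (σ (σ β)))))), ?_⟩
  have h2 : (2 : K) = 0 := CharTwo.two_eq_zero
  simp only [map_add, map_mul, h8]
  generalize σ (σ (σ (σ (σ (σ (σ e)))))) = e7 at *
  generalize σ (σ (σ (σ (σ (σ e))))) = e6 at *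
  generalize σ (σ (σ (σ (σ e)))) = e5 at *
  generalize σ (σ (σ (σ e))) = e4 at *
  generalize σ (σ (σ e)) = e3 at *
  generalize σ (σ e) = e2 at *
  generalize σ e = e1 at *
  generalize σ (σ (σ (σ (σ (σ (σ β)))))) = b7 at *
  generalize σ (σ (σ (σ (σ (σ β))))) = b6 at *
  generalize σ (σ (σ (σ (σ β)))) = b5 at *
  generalize σ (σ (σ (σ β))) = b4 at *
  generalize σ (σ (σ β)) = b3 at *
  generalize σ (σ β) = b2 at *
  generalize σ β = b1 at *
  linear_combination β * he + e * hβ + (-e * β + e1 * b2 + (e1 + e2) * b3 + (e1 + e2 + e3) * b4 +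
    (e1 + e2 + e3 + e4) * b5 + (e1 + e2 + e3 + e4 + e5) * b6 +
    (e1 + e2 + e3 + e4 + e5 + e6) * b7) * h2

/-- `x ↦ x ^ 2 + x` has image of index two on the fixed field. -/
theorem artinSchreier_add {K : Type*} [Field K] [Finite K] [CharP K 2] (σ : K →+* K) {a b : K}
    (ha : σ a = a) (hb : σ b = b) (hna : ¬ ∃ z, σ z = z ∧ z ^ 2 + z = a)
    (hnb : ¬ ∃ z, σ z = z ∧ z ^ 2 + z = b) : ∃ z, σ z = z ∧ z ^ 2 + z = a + b := by
  classical
  have := Fintype.ofFinite K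
  have h2 : (2 : K) = 0 := CharTwo.two_eq_zero
  set k : Finset K := {x | σ x = x} with hk
  set I : Finset K := k.image (fun z => z ^ 2 + z) with hI
  have memI : ∀ c, c ∈ I ↔ ∃ z, σ z = z ∧ z ^ 2 + z = c := by
    intro c
    simp [hI, hk]
  have hcard : #k ≤ 2 * #I := by
    refine Finset.card_le_mul_card_image k 2 fun c hc => ?_
    obtain ⟨z, hz, rfl⟩ := Finset.mem_image.1 hc
    refine (Finset.card_le_card (t := {z, z + 1}) ?_).trans Finset.card_le_two
    intro w hw
    have hw' : w ^ 2 + w = z ^ 2 + z := (Finset.mem_filter.1 hw).2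
    have h3 : (w + z) * (w + (z + 1)) = 0 := by
      linear_combination hw' + (z ^ 2 + w * z + z) * h2
    rcases mul_eq_zero.1 h3 with h | h
    · simp [CharTwo.add_eq_zero.1 h]
    · simp [CharTwo.add_eq_zero.1 h]
  set J : Finset K := I.image (fun c => a + c) with hJ
  have hJcard : #J = #I := Finset.card_image_of_injective _ (add_right_injective a)
  have hdisj : Disjoint I J := by
    rw [Finset.disjoint_left]
    intro c hc hcJ
    obtain ⟨d, hd, rfl⟩ := Finset.mem_image.1 hcJ
    obtain ⟨z, hz, hz'⟩ := (memI _).1 hc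
    obtain ⟨w, hw, hw'⟩ := (memI _).1 hd
    refine hna ⟨z + w, by simp [hz, hw], ?_⟩
    linear_combination hz' + hw' + (z * w + d) * h2
  have hsub : I ∪ J ⊆ k := by
    intro c hc
    rcases Finset.mem_union.1 hc with hc | hc
    · obtain ⟨z, hz, rfl⟩ := (memI _).1 hc
      simp [hk, hz]
    · obtain ⟨d, hd, rfl⟩ := Finset.mem_image.1 hc
      obtain ⟨z, hz, rfl⟩ := (memI _).1 hd
      simp [hk, hz, ha]
  have heq := Finset.eq_of_subset_of_card_le hsub (by
    rw [Finset.card_union_of_disjoint hdisj]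
    omega)
  have hbk : b ∈ I ∪ J := by
    rw [heq]
    simp [hk, hb]
  rcases Finset.mem_union.1 hbk with h | h
  · exact absurd ((memI _).1 h) hnb
  · obtain ⟨d, hd, rfl⟩ := Finset.mem_image.1 h
    obtain ⟨z, hz, hz'⟩ := (memI _).1 hd
    exact ⟨z, hz, by linear_combination hz' - a * h2⟩

theorem exists_not_artinSchreier {K : Type*} [Field K] [Fintype K] [DecidableEq K] [CharP K 2]
    {e q : ℕ} (he : 0 < e) (hq : q = 2 ^ e) (σ : K →+* K) (hfix : ∀ x, σ x = x → x ^ q = x)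
    (hk : q ≤ #{x | σ x = x}) {τ H : K} (hτ : τ + σ τ = 1) (hH : H ≠ 0) :
    ∃ x, σ x = x ∧ ¬ ∃ z, σ z = z ∧ z ^ 2 + z = H / (x + τ) + σ H / (x + σ τ) := by
  by_contra! hcon
  have h2 : (2 : K) = 0 := CharTwo.two_eq_zero
  obtain ⟨n, rfl⟩ : ∃ n, e = n + 1 := ⟨e - 1, by omega⟩
  set τ' := σ τ with hτ'
  set H' := σ H with hH'
  set P : K[X] := ∑ i ∈ Finset.range (n + 1),
    (C H * (X + C τ') + C H' * (X + C τ)) ^ 2 ^ i *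
      ((X + C τ) * (X + C τ')) ^ (2 ^ n - 2 ^ i) with hP
  have hdeg : P.natDegree ≤ q - 1 := by
    refine natDegree_sum_le_of_forall_le _ _ fun i hi => ?_
    have hi' : i ≤ n := by
      have := Finset.mem_range.1 hi
      omega
    have h1 : (C H * (X + C τ') + C H' * (X + C τ)).natDegree ≤ 1 := by compute_degree
    have h3 : ((X + C τ) * (X + C τ')).natDegree ≤ 2 := by compute_degree
    refine natDegree_mul_le.trans ?_
    refine (Nat.add_le_add (natDegree_pow_le_of_le _ h1) (natDegree_pow_le_of_le _ h3)).trans ?_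
    have h4 : 2 ^ i ≤ 2 ^ n := Nat.pow_le_pow_right (by norm_num) hi'
    have h5 : 0 < 2 ^ i := by positivity
    rw [hq, pow_succ]
    omega
  have hP0 : P = 0 := by
    refine eq_zero_of_natDegree_lt_card_of_eval_eq_zero' P ({x | σ x = x} : Finset K) ?_ ?_
    · intro x hx
      have hx' : σ x = x := by simpa using hx
      obtain ⟨z, hz, hzρ⟩ := hcon x hx'
      have hne : x + τ ≠ 0 := by
        intro h
        have h' : x = τ := CharTwo.add_eq_zero.1 h
        rw [hτ', ← h', hx', CharTwo.add_self_eq_zero] at hτ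
        exact zero_ne_one hτ
      have hne' : x + τ' ≠ 0 := by
        have : x + τ' = σ (x + τ) := by simp [hx', hτ']
        rw [this]
        exact (map_ne_zero σ).2 hne
      have hnum : H * (x + τ') + H' * (x + τ) = (z ^ 2 + z) * ((x + τ) * (x + τ')) := by
        rw [hzρ]
        field_simp
      have hterm : ∀ i ∈ Finset.range (n + 1),
          eval x ((C H * (X + C τ') + C H' * (X + C τ)) ^ 2 ^ i *
            ((X + C τ) * (X + C τ')) ^ (2 ^ n - 2 ^ i)) =
          (z ^ 2 ^ (i + 1) - z ^ 2 ^ i) * ((x + τ) * (x + τ')) ^ 2 ^ n := by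
        intro i hi
        have hi' : i ≤ n := by
          have := Finset.mem_range.1 hi
          omega
        have h4 : 2 ^ i ≤ 2 ^ n := Nat.pow_le_pow_right (by norm_num) hi'
        simp only [eval_mul, eval_pow, eval_add, eval_C, eval_X]
        rw [hnum, mul_pow, mul_assoc, ← pow_add, Nat.add_sub_cancel' h4, add_pow_char_pow,
          ← pow_mul, ← pow_succ', CharTwo.sub_eq_add]
      rw [hP, eval_finsetSum, Finset.sum_congr rfl hterm, ← Finset.sum_mul,
        Finset.sum_range_sub (fun i => z ^ 2 ^ i), ← hq, hfix z hz]
      simp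
    · have : 0 < q := by rw [hq]; positivity
      omega
  have heval : eval τ P = H ^ 2 ^ n := by
    rw [hP, eval_finsetSum, Finset.sum_eq_single n]
    · simp [hτ, CharTwo.add_self_eq_zero]
    · intro i hi hin
      have hi' : i < n := by
        have := Finset.mem_range.1 hi
        omega
      have h4 : 2 ^ i < 2 ^ n := Nat.pow_lt_pow_right (by norm_num) hi'
      simp [CharTwo.add_self_eq_zero]
      right
      omega
    · simp
  rw [hP0, eval_zero] at heval
  exact hH (eq_zero_of_pow_eq_zero heval.symm)

theorem not_artinSchreier_norm {K : Type*} [Field K] [CharP K 2] (σ : K →+* K) {τ : K}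
    (hτ : τ + σ τ = 1) : ¬ ∃ z, σ z = z ∧ z ^ 2 + z = τ ^ 2 + τ := by
  rintro ⟨z, hz, h⟩
  have h2 : (2 : K) = 0 := CharTwo.two_eq_zero
  have h3 : (z + τ) * (z + (τ + 1)) = 0 := by
    linear_combination h + (τ ^ 2 + z * τ + τ) * h2
  have key : σ τ = τ := by
    rcases mul_eq_zero.1 h3 with h | h
    · rw [← CharTwo.add_eq_zero.1 h, hz]
    · have h4 := CharTwo.add_eq_zero.1 h
      have h5 := congrArg σ h4
      rw [map_add, map_one, hz, h4] at h5
      exact (add_right_cancel h5).symm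
  rw [key, CharTwo.add_self_eq_zero] at hτ
  exact zero_ne_one hτ

theorem exists_tau_v {K : Type*} [Field K] [Fintype K] [CharP K 2]
    {e q : ℕ} (he : 0 < e) (hq : q = 2 ^ e) (hcard : Fintype.card K = q ^ 8) (σ : K →+* K)
    (h8 : ∀ x, σ (σ (σ (σ (σ (σ (σ (σ x))))))) = x) (hfix : ∀ x, σ x = x ↔ x ^ q = x)
    {H : K} (hH : H ≠ 0) (hσH : σ (σ H) = H) :
    ∃ τ v : K, τ + σ τ = 1 ∧ σ (σ v) = v + 1 ∧ τ ^ 2 * (v ^ 2 + v) = H ^ 2 := by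
  classical
  have h2 : (2 : K) = 0 := CharTwo.two_eq_zero
  have hq1 : 1 < q := by
    rw [hq]
    exact Nat.one_lt_two_pow (by omega)
  obtain ⟨β, hβ⟩ := exists_trace_eq_one hq1 hcard σ h8 hfix
  have hτ₀ : (β + σ (σ β) + σ (σ (σ (σ β))) + σ (σ (σ (σ (σ (σ β)))))) +
      σ (β + σ (σ β) + σ (σ (σ (σ β))) + σ (σ (σ (σ (σ (σ β)))))) = 1 := by
    simp only [map_add]
    linear_combination hβ
  generalize β + σ (σ β) + σ (σ (σ (σ β))) + σ (σ (σ (σ (σ (σ β))))) = τ₀ at hτ₀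
  obtain ⟨x, hx, hρ⟩ := exists_not_artinSchreier he hq σ (fun x => (hfix x).1)
    (le_card_fixed hcard σ h8) hτ₀ hH
  have hτ : (x + τ₀) + σ (x + τ₀) = 1 := by
    rw [map_add, hx]
    linear_combination hτ₀ + x * h2
  have hρ' : ¬ ∃ z, σ z = z ∧ z ^ 2 + z = H / (x + τ₀) + σ (H / (x + τ₀)) := by
    rwa [map_div₀, map_add, hx]
  generalize x + τ₀ = τ at hτ hρ'
  have hτ1 : σ τ = τ + 1 := by linear_combination hτ - τ * h2
  have hτne : τ ≠ 0 := by
    rintro rfl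
    simp at hτ
  have hσθ : σ (σ (H / τ)) = H / τ := by
    rw [map_div₀, map_div₀, hσH, hτ1, map_add, hτ1, map_one]
    congr 1
    linear_combination h2
  have hθ : τ ^ 2 * (H / τ) ^ 2 = H ^ 2 := by field_simp
  generalize H / τ = θ at hρ' hσθ hθ
  have hN : ¬ ∃ z, σ z = z ∧ z ^ 2 + z = τ ^ 2 + τ := not_artinSchreier_norm σ hτ
  have hNfix : σ (τ ^ 2 + τ) = τ ^ 2 + τ := by
    rw [map_add, map_pow, hτ1]
    linear_combination (τ + 1) * h2
  have hρfix : σ (θ + σ θ) = θ + σ θ := by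
    rw [map_add, hσθ, add_comm]
  obtain ⟨z, hz, hzρ⟩ := artinSchreier_add σ hρfix hNfix hρ' hN
  obtain ⟨V, hV⟩ := exists_map_add_self_eq σ h8 hβ (τ + z) (by
    simp only [map_add, hz, hτ1, map_one]
    linear_combination (4 * τ + 4 * z + 14) * h2)
  have hV1 : σ V = V + τ + z := by linear_combination hV - V * h2
  have hV2 : σ (σ V) = V + 1 := by
    rw [hV1]
    simp only [map_add, hV1, hτ1, hz]
    linear_combination (τ + z) * h2
  have hκ : σ (V ^ 2 + V + θ) = V ^ 2 + V + θ := by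
    simp only [map_add, map_pow, hV1]
    linear_combination hzρ + (V * τ + V * z + τ * z + τ + τ ^ 2 + σ θ) * h2
  by_cases hκAS : ∃ w, σ w = w ∧ w ^ 2 + w = V ^ 2 + V + θ
  · obtain ⟨w, hw, hwκ⟩ := hκAS
    refine ⟨τ, (V + w) ^ 2, hτ, ?_, ?_⟩
    · simp only [map_pow, map_add, hV2, hw]
      linear_combination (V + w) * h2
    · have h1 : (V + w) ^ 2 + (V + w) = θ := by
        linear_combination hwκ + (V ^ 2 + V + V * w) * h2
      rw [← hθ, ← h1]
      linear_combination (-τ ^ 2 * (V + w) ^ 3) * h2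
  · obtain ⟨w, hw, hwκ⟩ := artinSchreier_add σ hκ hNfix hκAS hN
    refine ⟨τ, (V + τ + w) ^ 2, hτ, ?_, ?_⟩
    · simp only [map_pow, map_add, hV2, hw, hτ1, map_one]
      linear_combination (3 * (V + τ + w) + 4) * h2
    · have h1 : (V + τ + w) ^ 2 + (V + τ + w) = θ := by
        linear_combination hwκ + (V ^ 2 + V + τ ^ 2 + τ + V * w + V * τ + τ * w) * h2
      rw [← hθ, ← h1]
      linear_combination (-τ ^ 2 * (V + τ + w) ^ 3) * h2

section Candidates

variable {K : Type*} [Field K] [CharP K 2]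

theorem two_candidates_add (κ m r τ v : K)
    (hv : v ^ 2 + v = r * m * τ + (m + r ^ 2 * m ^ 2) * τ ^ 2)
    (hτ : τ ^ 2 + τ = κ ^ 2 + κ + r * m + (m + r ^ 2 * m ^ 2)) :
    ((1 + r ^ 2 * m) * (v + κ * τ) + r * v * (κ + τ + v + 1)) ^ 2 +
      ((1 + r ^ 2 * m) * (v + κ * τ) + r * v * (κ + τ + v + 1)) +
      (τ * (v + r ^ 2 * m) + r * v) * ((τ + 1) * (κ + τ + v + 1 + r ^ 2 * m) +
        r * (κ + τ + v + 1)) +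
      τ * (v + 1) * ((τ + 1) * (κ + τ + v)) + (τ ^ 2 + τ) =
    (κ ^ 2 * r ^ 3 * m ^ 2 + κ ^ 2 * r ^ 2 * m + κ ^ 2 * r * m + κ ^ 2 + κ + κ * r ^ 3 * m ^ 2 +
      κ * r ^ 2 * m + κ * r * m + r ^ 5 * m ^ 4 + r ^ 3 * m ^ 2 + r ^ 2 * m ^ 2 + r * m ^ 2 +
      r * m + m) ^ 2 +
    (κ ^ 2 * r ^ 3 * m ^ 2 + κ ^ 2 * r ^ 2 * m + κ ^ 2 * r * m + κ ^ 2 + κ + κ * r ^ 3 * m ^ 2 +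
      κ * r ^ 2 * m + κ * r * m + r ^ 5 * m ^ 4 + r ^ 3 * m ^ 2 + r ^ 2 * m ^ 2 + r * m ^ 2 +
      r * m + m) := by
  have h2 : (2 : K) = 0 := CharTwo.two_eq_zero
  have hv' : v ^ 2 + v = r * m * τ +
      (m + r ^ 2 * m ^ 2) * (τ + (κ ^ 2 + κ + r * m + (m + r ^ 2 * m ^ 2))) := by
    linear_combination hv + (m + r ^ 2 * m ^ 2) * (hτ - τ * h2)
  linear_combination (norm := skip) (v ^ 2 * r ^ 2 + v * r ^ 2 + τ ^ 2 * r ^ 2 + τ * r ^ 4 * m ^ 2 +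
    τ * r ^ 3 * m + τ * r ^ 2 * m + κ ^ 2 * r ^ 4 * m ^ 2 + κ ^ 2 * r ^ 2 * m + κ ^ 2 * r ^ 2 +
    κ * r ^ 4 * m ^ 2 + κ * r ^ 2 * m + r ^ 6 * m ^ 4 + r ^ 5 * m ^ 3 + r ^ 4 * m ^ 2 +
    r ^ 3 * m ^ 2 + r ^ 2 * m ^ 2 + r ^ 2 + 1) * hv' +
    (v * r ^ 2 + τ * r ^ 4 * m ^ 2 + τ * r ^ 3 * m + τ + κ ^ 2 * r ^ 2 * m + κ ^ 2 +
    κ * r ^ 4 * m ^ 2 + κ + r ^ 5 * m ^ 3 + r ^ 4 * m ^ 2 + r ^ 3 * m ^ 2 + 1) * hτ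
  clear hv hv' hτ
  grind

/-- `Y` and `Z` solve the equations over `s` and `u` from which `IsSolution.exists_multiplier`
extracts an element of norm one over the fixed field of `σ ^ 4`. -/
structure IsSolution (σ : K →+* K) (s u Y Z : K) : Prop where
  fixed : σ (σ (σ (σ Y))) = Y
  trace : Y + σ Y + σ (σ Y) + σ (σ (σ Y)) = 1
  norm : Y * σ (σ Y) = u ^ 2 * (σ s ^ 2 + σ s) * (σ (σ (σ s)) ^ 2 + σ (σ (σ s)))
  map_add_self : σ Z + Z = u * (σ s ^ 2 + σ s) + Y + σ s + 1
  quad : Z ^ 2 + Z = u ^ 2 * (s ^ 2 + s) * (σ s ^ 2 + σ s) + Y * σ (σ (σ Y))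

theorem quad_fixed (σ : K →+* K) {s u Y Z : K}
    (hu : u * (1 + s + σ s + σ (σ s) + σ (σ (σ s))) = 1) (hσu : σ u = u)
    (fixed : σ (σ (σ (σ Y))) = Y)
    (trace : Y + σ Y + σ (σ Y) + σ (σ (σ Y)) = 1)
    (norm : Y * σ (σ Y) = u ^ 2 * (σ s ^ 2 + σ s) * (σ (σ (σ s)) ^ 2 + σ (σ (σ s))))
    (map_add_self : σ Z + Z = u * (σ s ^ 2 + σ s) + Y + σ s + 1) :
    σ (Z ^ 2 + Z + (u ^ 2 * (s ^ 2 + s) * (σ s ^ 2 + σ s) + Y * σ (σ (σ Y)))) =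
      Z ^ 2 + Z + (u ^ 2 * (s ^ 2 + s) * (σ s ^ 2 + σ s) + Y * σ (σ (σ Y))) := by
  have h2 : (2 : K) = 0 := CharTwo.two_eq_zero
  have h : σ Z = u * (σ s ^ 2 + σ s) + Y + σ s + 1 + Z := by
    linear_combination map_add_self - Z * h2
  simp only [map_mul, map_pow, hσu, h, fixed, map_add]
  generalize σ (σ (σ s)) = s3 at *
  generalize σ (σ s) = s2 at *
  generalize σ s = s1 at *
  generalize σ (σ (σ Y)) = y3 at *
  generalize σ (σ Y) = y2 at *
  generalize σ Y = y1 at *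
  clear h map_add_self fixed
  grind

theorem isSolution_of_quad (σ : K →+* K) {s u Y Z w : K}
    (fixed : σ (σ (σ (σ Y))) = Y)
    (trace : Y + σ Y + σ (σ Y) + σ (σ (σ Y)) = 1)
    (norm : Y * σ (σ Y) = u ^ 2 * (σ s ^ 2 + σ s) * (σ (σ (σ s)) ^ 2 + σ (σ (σ s))))
    (map_add_self : σ Z + Z = u * (σ s ^ 2 + σ s) + Y + σ s + 1) (hw : σ w = w)
    (hwq : w ^ 2 + w = Z ^ 2 + Z + (u ^ 2 * (s ^ 2 + s) * (σ s ^ 2 + σ s) + Y * σ (σ (σ Y)))) :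
    IsSolution σ s u Y (Z + w) := by
  have h2 : (2 : K) = 0 := CharTwo.two_eq_zero
  refine ⟨fixed, trace, norm, ?_, ?_⟩
  · rw [map_add, hw]
    linear_combination map_add_self + w * h2
  · linear_combination hwq + (Z ^ 2 + Z + Z * w) * h2

theorem exists_isSolution {K : Type*} [Field K] [Fintype K] [CharP K 2]
    {e q : ℕ} (he : 0 < e) (hq : q = 2 ^ e) (hcard : Fintype.card K = q ^ 8) (σ : K →+* K)
    (h8 : ∀ x, σ (σ (σ (σ (σ (σ (σ (σ x))))))) = x) (hfix : ∀ x, σ x = x ↔ x ^ q = x)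
    {s u : K} (hs : σ (σ (σ (σ s))) = s) (hs0 : s ≠ 0) (hs1 : s ≠ 1)
    (hu : u * (1 + s + σ s + σ (σ s) + σ (σ (σ s))) = 1) :
    ∃ Y Z, IsSolution σ s u Y Z := by
  have h2 : (2 : K) = 0 := CharTwo.two_eq_zero
  have hu0 : u ≠ 0 := left_ne_zero_of_mul_eq_one hu
  have hσu : σ u = u := by
    have h := congrArg σ hu
    simp only [map_mul, map_add, map_one, hs] at h
    refine mul_right_cancel₀ (right_ne_zero_of_mul_eq_one hu) ?_
    linear_combination h - hu
  have hγ : s ^ 2 + s ≠ 0 := by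
    have : s ^ 2 + s = s * (s + 1) := by ring
    rw [this]
    refine mul_ne_zero hs0 fun h => hs1 (CharTwo.add_eq_zero.1 h)
  obtain ⟨H, hH⟩ := FiniteField.isSquare_of_char_two (ringChar.eq K 2)
    (u ^ 2 * (σ s ^ 2 + σ s) * (σ (σ (σ s)) ^ 2 + σ (σ (σ s))))
  rw [← sq] at hH
  have hσγ : ∀ x, σ x ^ 2 + σ x = σ (x ^ 2 + x) := by simp
  have hH0 : H ≠ 0 := by
    rintro rfl
    rw [hσγ, hσγ] at hH
    have hn : u ^ 2 * σ (s ^ 2 + s) * σ (σ (σ s) ^ 2 + σ (σ s)) ≠ 0 := by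
      rw [hσγ, hσγ]
      simp only [ne_eq, mul_eq_zero, map_eq_zero, pow_eq_zero_iff, two_ne_zero, not_false_eq_true]
      tauto
    exact hn (by rw [hH]; ring)
  have hσH : σ (σ H) = H := by
    apply CharTwo.sq_injective
    change σ (σ H) ^ 2 = H ^ 2
    rw [← map_pow, ← map_pow, ← hH]
    simp only [map_mul, map_pow, map_add, hs, hσu]
    ring
  obtain ⟨τ, v, hτ, hv, hτv⟩ := exists_tau_v he hq hcard σ h8 hfix hH0 hσH
  obtain ⟨β', hβ⟩ := exists_trace_eq_one
    (by rw [hq]; exact Nat.one_lt_two_pow (by omega)) hcard σ h8 hfix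
  rw [← hH] at hτv
  have hτ0 : τ ≠ 0 := by
    rintro rfl
    simp at hτ
  have hτ1 : σ τ = τ + 1 := by linear_combination hτ - τ * h2
  obtain ⟨κ, hκ⟩ : ∃ κ, κ = τ + v + σ v := ⟨_, rfl⟩
  have hv1 : σ v = κ + τ + v := by rw [hκ]; linear_combination -(τ + v) * h2
  have hσκ : σ κ = κ := by
    rw [hκ]
    simp only [map_add, hv, hτ1]
    linear_combination h2
  -- coordinates of `(v ^ 2 + v) / τ` in the basis `1, τ`
  obtain ⟨g, hg⟩ : ∃ g, v ^ 2 + v = τ * g := ⟨(v ^ 2 + v) / τ, by field_simp⟩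
  have hσg : σ (σ g) = g := by
    have h := congrArg (fun x => σ (σ x)) hg
    simp only [map_add, map_mul, map_pow, hv, hτ1, map_one] at h
    refine mul_left_cancel₀ hτ0 ?_
    rw [← hg]
    linear_combination -h + (v + 1 - σ (σ g)) * h2
  obtain ⟨b, hb⟩ : ∃ b, b = g + σ g := ⟨_, rfl⟩
  have hσb : σ b = b := by
    rw [hb, map_add, hσg, add_comm]
  obtain ⟨a, ha⟩ : ∃ a, a = g + b * τ := ⟨_, rfl⟩
  have hσa : σ a = a := by
    rw [ha]
    simp only [map_add, map_mul, hσb, hτ1]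
    linear_combination hb + σ g * h2
  have hvab : v ^ 2 + v = a * τ + b * τ ^ 2 := by
    rw [hg, ha]
    linear_combination -(b * τ ^ 2) * h2
  have hm0 : a ^ 2 + b ≠ 0 := by
    intro h
    have h3 : (v + a * τ) * (v + (a * τ + 1)) = 0 := by
      linear_combination hvab + τ ^ 2 * h + (v * a * τ + a * τ) * h2
    have key : σ (σ v) = v := by
      rcases mul_eq_zero.1 h3 with h | h
      · rw [CharTwo.add_eq_zero.1 h]
        simp only [map_mul, map_add, hσa, hτ1, map_one]
        linear_combination a * h2
      · rw [CharTwo.add_eq_zero.1 h]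
        simp only [map_mul, map_add, hσa, hτ1, map_one]
        linear_combination a * h2
    rw [hv] at key
    exact one_ne_zero (add_eq_left.1 key)
  obtain ⟨m, hm⟩ : ∃ m, m = a ^ 2 + b := ⟨_, rfl⟩
  rw [← hm] at hm0
  obtain ⟨r, hr⟩ : ∃ r, r = a / m := ⟨_, rfl⟩
  have hσm : σ m = m := by simp [hm, hσa, hσb]
  have hσr : σ r = r := by rw [hr, map_div₀, hσa, hσm]
  obtain rfl : a = r * m := by rw [hr]; field_simp
  obtain rfl : b = m + r ^ 2 * m ^ 2 := by
    linear_combination -hm - r ^ 2 * m ^ 2 * h2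
  clear hr hm hb ha
  have hN : τ ^ 2 + τ = κ ^ 2 + κ + r * m + (m + r ^ 2 * m ^ 2) := by
    have h := congrArg σ hvab
    simp only [map_add, map_mul, map_pow, hv1, hτ1, hσr, hσm] at h
    clear * - h hvab h2
    grind
  obtain ⟨Ya, hYa⟩ : ∃ Ya, Ya = τ * (v + 1) := ⟨_, rfl⟩
  have hYa1 : σ Ya = (τ + 1) * (κ + τ + v + 1) := by
    simp only [hYa, map_add, map_mul, map_one, hv1, hτ1]
  have hYa2 : σ (σ Ya) = τ * v := by
    simp only [hYa1, map_add, map_mul, map_one, hv1, hτ1, hσκ]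
    clear * - h2
    grind
  have hYa3 : σ (σ (σ Ya)) = (τ + 1) * (κ + τ + v) := by
    simp only [hYa2, map_mul, hv1, hτ1]
  have hYa4 : σ (σ (σ (σ Ya))) = Ya := by
    simp only [hYa, map_add, map_mul, map_one, hv1, hτ1, hσκ]
    clear * - h2
    grind
  obtain ⟨Yb, hYb⟩ : ∃ Yb, Yb = τ * (v + r ^ 2 * m) + r * v := ⟨_, rfl⟩
  have hYb1 : σ Yb = (τ + 1) * (κ + τ + v + r ^ 2 * m) + r * (κ + τ + v) := by
    simp only [hYb, map_add, map_mul, map_pow, hv1, hτ1, hσr, hσm]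
  have hYb2 : σ (σ Yb) = τ * (v + 1 + r ^ 2 * m) + r * (v + 1) := by
    simp only [hYb1, map_add, map_mul, map_pow, map_one, hv1, hτ1, hσκ, hσr, hσm]
    clear * - h2
    grind
  have hYb3 : σ (σ (σ Yb)) =
      (τ + 1) * (κ + τ + v + 1 + r ^ 2 * m) + r * (κ + τ + v + 1) := by
    simp only [hYb2, map_add, map_mul, map_pow, map_one, hv1, hτ1, hσr, hσm]
  have hYb4 : σ (σ (σ (σ Yb))) = Yb := by
    simp only [hYb, map_add, map_mul, map_pow, map_one, hv1, hτ1, hσκ, hσr, hσm]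
    clear * - h2
    grind
  have trace_a : Ya + σ Ya + σ (σ Ya) + σ (σ (σ Ya)) = 1 := by
    rw [hYa3, hYa2, hYa1, hYa]
    clear * - h2
    grind
  have trace_b : Yb + σ Yb + σ (σ Yb) + σ (σ (σ Yb)) = 1 := by
    rw [hYb3, hYb2, hYb1, hYb]
    clear * - h2
    grind
  have norm_a : Ya * σ (σ Ya) =
      u ^ 2 * (σ s ^ 2 + σ s) * (σ (σ (σ s)) ^ 2 + σ (σ (σ s))) := by
    rw [hYa2, hYa, ← hτv]
    ring
  have norm_b : Yb * σ (σ Yb) =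
      u ^ 2 * (σ s ^ 2 + σ s) * (σ (σ (σ s)) ^ 2 + σ (σ (σ s))) := by
    rw [hYb2, hYb, ← hτv]
    clear * - h2 hvab
    grind
  obtain ⟨Za, hZa⟩ := exists_map_add_self_eq σ h8 hβ
    (u * (σ s ^ 2 + σ s) + Ya + σ s + 1) (by
      simp only [map_add, map_mul, map_pow, map_one, hs, hσu, hYa4]
      clear * - h2
      grind)
  obtain ⟨D, hD⟩ : ∃ D, D = (1 + r ^ 2 * m) * (v + κ * τ) + r * v * (κ + τ + v + 1) :=
    ⟨_, rfl⟩
  have hσD : σ D + D = Ya + Yb := by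
    simp only [hD, hYa, hYb, map_add, map_mul, map_pow, map_one, hv1, hτ1, hσκ, hσr, hσm]
    clear * - h2
    grind
  have hZb : σ (Za + D) + (Za + D) = u * (σ s ^ 2 + σ s) + Yb + σ s + 1 := by
    rw [map_add]
    linear_combination hZa + hσD + Ya * h2
  have hca := quad_fixed σ hu hσu hYa4 trace_a norm_a hZa
  have hNfix : σ (τ ^ 2 + τ) = τ ^ 2 + τ := by
    rw [map_add, map_pow, hτ1]
    linear_combination (τ + 1) * h2
  have hNnot := not_artinSchreier_norm σ hτ
  by_cases hAS : ∃ z, σ z = z ∧ z ^ 2 + z =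
      Za ^ 2 + Za + (u ^ 2 * (s ^ 2 + s) * (σ s ^ 2 + σ s) + Ya * σ (σ (σ Ya)))
  · obtain ⟨w, hw, hwq⟩ := hAS
    exact ⟨Ya, Za + w, isSolution_of_quad σ hYa4 trace_a norm_a hZa hw hwq⟩
  · obtain ⟨w, hw, hwq⟩ := artinSchreier_add σ hca hNfix hAS hNnot
    have hE := two_candidates_add κ m r τ v hvab hN
    rw [← hD, ← hYb, ← hYa, ← hYa3, ← hYb3] at hE
    obtain ⟨z, hz⟩ : ∃ z, z = κ ^ 2 * r ^ 3 * m ^ 2 + κ ^ 2 * r ^ 2 * m + κ ^ 2 * r * m + κ ^ 2 +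
      κ + κ * r ^ 3 * m ^ 2 + κ * r ^ 2 * m + κ * r * m + r ^ 5 * m ^ 4 + r ^ 3 * m ^ 2 +
      r ^ 2 * m ^ 2 + r * m ^ 2 + r * m + m := ⟨_, rfl⟩
    have hσz : σ z = z := by
      simp only [hz, map_add, map_mul, map_pow, hσκ, hσr, hσm]
    rw [← hz] at hE
    refine ⟨Yb, Za + D + (w + z), isSolution_of_quad σ hYb4 trace_b norm_b hZb
      (by rw [map_add, hw, hσz]) ?_⟩
    linear_combination hwq - hE + (w * z - Za * D + Ya * σ (σ (σ Ya)) + τ + τ ^ 2) * h2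

end Candidates

section NormOne

variable {K : Type*} [Field K] [CharP K 2]

theorem cross_relation_homogeneous {n s0 s1 s2 s3 y0 y1 y2 y3 W W1 W2 W3 : K}
    (hn : n = 1 + s0 + s1 + s2 + s3) (hy : y3 = n + y0 + y1 + y2)
    (hW : W * (W + n) = (s0 ^ 2 + s0) * (s1 ^ 2 + s1) + y0 * y3)
    (hR0 : y0 * y2 = (s1 ^ 2 + s1) * (s3 ^ 2 + s3))
    (hR1 : y1 * y3 = (s2 ^ 2 + s2) * (s0 ^ 2 + s0))
    (h1 : W1 = W + (s1 ^ 2 + s1) + y0 + n * (s1 + 1))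
    (h2 : W2 = W1 + (s2 ^ 2 + s2) + y1 + n * (s2 + 1))
    (h3 : W3 = W2 + (s3 ^ 2 + s3) + y2 + n * (s3 + 1)) :
    (s3 ^ 2 + s3) * ((W1 + n) * ((s0 + s1) * W + n * s0 * (1 + s1))) =
      y0 * (W3 * ((1 + s2 + s3) * W2 + n * s2 * s3)) := by
  subst h3 h2 h1 hy hn
  linear_combination (norm := skip) (y0 * s2 + y0 * s3 + y0 + s0 * s3 ^ 2 + s0 * s3 + s1 * s3 ^ 2 +
    s1 * s3) * hW + (y0 * s2 + y0 * s3 + y0) * hR1 + (W * s2 + W * s3 + W + s0 * s1 * s2 +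
    s0 * s1 * s3 + s0 * s1 + s0 * s2 ^ 2 + s0 * s2 + s0 * s3 ^ 2 + s0 * s3) * hR0
  have h2 : (2 : K) = 0 := CharTwo.two_eq_zero
  clear hW hR0 hR1
  grind

theorem cross_relation {u s0 s1 s2 s3 y0 y1 y2 y3 W W1 W2 W3 : K}
    (hu : u * (1 + s0 + s1 + s2 + s3) = 1) (hy : y0 + y1 + y2 + y3 = 1)
    (hW : W ^ 2 + W = u ^ 2 * (s0 ^ 2 + s0) * (s1 ^ 2 + s1) + y0 * y3)
    (hR0 : y0 * y2 = u ^ 2 * (s1 ^ 2 + s1) * (s3 ^ 2 + s3))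
    (hR1 : y1 * y3 = u ^ 2 * (s2 ^ 2 + s2) * (s0 ^ 2 + s0))
    (h1 : W1 + W = u * (s1 ^ 2 + s1) + y0 + s1 + 1)
    (h2 : W2 + W1 = u * (s2 ^ 2 + s2) + y1 + s2 + 1)
    (h3 : W3 + W2 = u * (s3 ^ 2 + s3) + y2 + s3 + 1) :
    u * (s3 ^ 2 + s3) * (W1 + 1) * ((s0 + s1) * W + s0 * (1 + s1)) =
      y0 * W3 * ((1 + s2 + s3) * W2 + s2 * s3) := by
  have hc : (2 : K) = 0 := CharTwo.two_eq_zero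
  obtain ⟨n, hn⟩ : ∃ n, n = 1 + s0 + s1 + s2 + s3 := ⟨_, rfl⟩
  rw [← hn] at hu
  have hn0 : n ≠ 0 := right_ne_zero_of_mul_eq_one hu
  have h := cross_relation_homogeneous (y0 := n * y0) (y1 := n * y1) (y2 := n * y2) (y3 := n * y3)
    (W := n * W) (W1 := n * W1) (W2 := n * W2) (W3 := n * W3) hn
    (by linear_combination n * hy - n * (y0 + y1 + y2) * hc)
    (by linear_combination n ^ 2 * hW + (s0 ^ 2 + s0) * (s1 ^ 2 + s1) * (u * n + 1) * hu)
    (by linear_combination n ^ 2 * hR0 + (s1 ^ 2 + s1) * (s3 ^ 2 + s3) * (u * n + 1) * hu)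
    (by linear_combination n ^ 2 * hR1 + (s2 ^ 2 + s2) * (s0 ^ 2 + s0) * (u * n + 1) * hu)
    (by linear_combination n * h1 + (s1 ^ 2 + s1) * hu - n * W * hc)
    (by linear_combination n * h2 + (s2 ^ 2 + s2) * hu - n * W1 * hc)
    (by linear_combination n * h3 + (s3 ^ 2 + s3) * hu - n * W2 * hc)
  refine mul_left_cancel₀ (pow_ne_zero 3 hn0) ?_
  linear_combination h + n ^ 2 * (s3 ^ 2 + s3) * (W1 + 1) * ((s0 + s1) * W + s0 * (1 + s1)) * hu

theorem product_relation {u s0 s1 s2 s3 y0 y1 y2 y3 W W1 W2 W3 : K} (hy0 : y0 ≠ 0) (hW3 : W3 ≠ 0)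
    (hu : u * (1 + s0 + s1 + s2 + s3) = 1) (hy : y0 + y1 + y2 + y3 = 1)
    (hW : W ^ 2 + W = u ^ 2 * (s0 ^ 2 + s0) * (s1 ^ 2 + s1) + y0 * y3)
    (hW1 : W1 ^ 2 + W1 = u ^ 2 * (s1 ^ 2 + s1) * (s2 ^ 2 + s2) + y1 * y0)
    (hW2 : W2 ^ 2 + W2 = u ^ 2 * (s2 ^ 2 + s2) * (s3 ^ 2 + s3) + y2 * y1)
    (hW3' : W3 ^ 2 + W3 = u ^ 2 * (s3 ^ 2 + s3) * (s0 ^ 2 + s0) + y3 * y2)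
    (hR0 : y0 * y2 = u ^ 2 * (s1 ^ 2 + s1) * (s3 ^ 2 + s3))
    (hR1 : y1 * y3 = u ^ 2 * (s2 ^ 2 + s2) * (s0 ^ 2 + s0))
    (h1 : W1 + W = u * (s1 ^ 2 + s1) + y0 + s1 + 1)
    (h2 : W2 + W1 = u * (s2 ^ 2 + s2) + y1 + s2 + 1)
    (h3 : W3 + W2 = u * (s3 ^ 2 + s3) + y2 + s3 + 1) :
    (W2 ^ 2 + W2) * (W3 + 1) * (W1 + 1) * ((s0 + s1) * W + s0 * (1 + s1)) ^ 2 =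
      (W ^ 2 + W) * W1 * W3 * ((1 + s2 + s3) * W2 + s2 * s3) ^ 2 := by
  have key := cross_relation hu hy hW hR0 hR1 h1 h2 h3
  clear h1 h2 h3 hu hy
  generalize (s0 + s1) * W + s0 * (1 + s1) = D0 at *
  generalize (1 + s2 + s3) * W2 + s2 * s3 = D2 at *
  generalize s0 ^ 2 + s0 = g0 at *
  generalize s1 ^ 2 + s1 = g1 at *
  generalize s2 ^ 2 + s2 = g2 at *
  generalize s3 ^ 2 + s3 = g3 at *
  have hX : y0 ^ 2 * (W2 ^ 2 + W2) * (W3 ^ 2 + W3) =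
      u ^ 2 * g3 ^ 2 * (W ^ 2 + W) * (W1 ^ 2 + W1) := by
    rw [hW, hW1, hW2, hW3']
    linear_combination (u ^ 2 * g3 * g0 * y0 * y1 + (y0 * y2 + u ^ 2 * g1 * g3) * y1 * y3 +
      u ^ 2 * g2 * g3 * y0 * y3) * hR0 +
      (u ^ 4 * g1 ^ 2 * g3 ^ 2 - u ^ 2 * g3 ^ 2 * y0 ^ 2) * hR1
  have hne : y0 ^ 2 * W3 ≠ 0 := mul_ne_zero (pow_ne_zero 2 hy0) hW3
  refine mul_left_cancel₀ hne ?_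
  linear_combination (W1 + 1) * D0 ^ 2 * hX +
    (W ^ 2 + W) * W1 * (u * g3 * (W1 + 1) * D0 + y0 * W3 * D2) * key

end NormOne

section Multiplier

variable {K : Type*} [Field K] [Fintype K] [CharP K 2]

theorem IsSolution.exists_multiplier {σ : K →+* K} {s u Y Z : K}
    (hs : σ (σ (σ (σ s))) = s) (hs0 : s ≠ 0) (hs1 : s ≠ 1)
    (hu : u * (1 + s + σ s + σ (σ s) + σ (σ (σ s))) = 1) (h : IsSolution σ s u Y Z) :
    ∃ a, a * σ (σ (σ (σ a))) = 1 ∧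
      ((1 + s) * σ s * a + s * (1 + σ s) * σ (σ (σ (σ a)))) *
        σ (σ (σ (σ (σ (σ (σ a)))))) =
      σ a * ((1 + σ (σ s)) * (1 + σ (σ (σ s))) * σ (σ a) +
        σ (σ s) * σ (σ (σ s)) * σ (σ (σ (σ (σ (σ a)))))) := by
  have h2 : (2 : K) = 0 := CharTwo.two_eq_zero
  have hu0 : u ≠ 0 := left_ne_zero_of_mul_eq_one hu
  have hσu : σ u = u := by
    have h := congrArg σ hu
    simp only [map_mul, map_add, map_one, hs] at h
    refine mul_right_cancel₀ (right_ne_zero_of_mul_eq_one hu) ?_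
    linear_combination h - hu
  have hγ : s ^ 2 + s ≠ 0 := by
    have : s ^ 2 + s = s * (s + 1) := by ring
    rw [this]
    exact mul_ne_zero hs0 fun h => hs1 (CharTwo.add_eq_zero.1 h)
  have hσγ : ∀ x, σ x ^ 2 + σ x = σ (x ^ 2 + x) := by simp
  have hY0 : Y ≠ 0 := by
    intro hY
    have hn := h.norm
    rw [hY, zero_mul, hσγ, hσγ, hσγ, hσγ, eq_comm] at hn
    simp only [mul_eq_zero, map_eq_zero, pow_eq_zero_iff, ne_eq, two_ne_zero, not_false_eq_true,
      hu0, hγ, or_self] at hn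
  have e1 := h.map_add_self
  have e2 := congrArg σ e1
  have e3 := congrArg σ e2
  have e4 := congrArg σ e3
  have q1 := congrArg σ h.quad
  have q2 := congrArg σ q1
  have q3 := congrArg σ q2
  have r1 := congrArg σ h.norm
  have r2 := congrArg σ r1
  simp only [map_mul, map_add, map_pow, map_one, hs, hσu, h.fixed] at e2 e3 e4 q1 q2 q3 r1 r2
  have hZ4 : σ (σ (σ (σ Z))) = Z + 1 := by
    have ht := h.trace
    clear q1 q2 q3 r1 r2
    linear_combination (norm := skip) e1 + e2 + e3 + e4 + ht +
      (s + σ s + σ (σ s) + σ (σ (σ s))) * hu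
    clear * - h2
    grind
  have hZ : ∀ c, σ c = c → Z ≠ c := by
    rintro c hc rfl
    simp only [hc] at hZ4
    simp at hZ4
  have hZ0 := hZ 0 (map_zero σ)
  have hZ1 : Z + 1 ≠ 0 := fun h0 => hZ 1 (map_one σ) (CharTwo.add_eq_zero.1 h0)
  have key := product_relation hY0 (by simpa using hZ0) hu h.trace h.quad (by rw [q1]) (by rw [q2])
    (by rw [q3]) (by rw [h.norm]) (by rw [r1]) e1 e2 e3
  obtain ⟨a, ha⟩ := FiniteField.isSquare_of_char_two (ringChar.eq K 2) (Z / (Z + 1))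
  rw [← sq] at ha
  have hZ5 : σ (Z + 1) ≠ 0 := (map_ne_zero σ).2 hZ1
  have hZ6 : σ (σ (Z + 1)) ≠ 0 := (map_ne_zero σ).2 ((map_ne_zero σ).2 hZ1)
  have hZ7 : σ (σ (σ (Z + 1))) ≠ 0 :=
    (map_ne_zero σ).2 ((map_ne_zero σ).2 ((map_ne_zero σ).2 hZ1))
  rw [map_add, map_one] at hZ5
  simp only [map_add, map_one] at hZ6 hZ7
  have hZ01 : σ Z ≠ 0 := by simpa using hZ0
  have hZ02 : σ (σ Z) ≠ 0 := by simpa using hZ0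
  have hZ03 : σ (σ (σ Z)) ≠ 0 := by simpa using hZ0
  have a0 : a ^ 2 = Z / (Z + 1) := ha.symm
  have a1 : σ a ^ 2 = σ Z / (σ Z + 1) := by rw [← map_pow, a0]; simp
  have a2 : σ (σ a) ^ 2 = σ (σ Z) / (σ (σ Z) + 1) := by rw [← map_pow, a1]; simp
  have a3 : σ (σ (σ a)) ^ 2 = σ (σ (σ Z)) / (σ (σ (σ Z)) + 1) := by rw [← map_pow, a2]; simp
  have hone : (1 : K) + 1 = 0 := CharTwo.add_self_eq_zero 1
  have a4 : σ (σ (σ (σ a))) ^ 2 = (Z + 1) / Z := by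
    rw [← map_pow, a3]; simp [hZ4, add_assoc, hone]
  have a6 : σ (σ (σ (σ (σ (σ a))))) ^ 2 = (σ (σ Z) + 1) / σ (σ Z) := by
    rw [← map_pow, ← map_pow, a4]; simp
  have a7 : σ (σ (σ (σ (σ (σ (σ a)))))) ^ 2 = (σ (σ (σ Z)) + 1) / σ (σ (σ Z)) := by
    rw [← map_pow, a6]; simp
  refine ⟨a, ?_, ?_⟩
  · apply CharTwo.sq_injective
    change (_) ^ 2 = 1 ^ 2
    rw [mul_pow, a0, a4]
    field_simp
  · apply CharTwo.sq_injective
    change (_) ^ 2 = (_) ^ 2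
    simp only [mul_pow, CharTwo.add_sq, a0, a1, a2, a4, a6, a7]
    clear * - key hZ0 hZ1 hZ5 hZ6 hZ7 hZ01 hZ02 hZ03 h2
    generalize σ (σ (σ Z)) = Z3 at *
    generalize σ (σ Z) = Z2 at *
    generalize σ Z = Z1 at *
    generalize σ (σ (σ s)) = s3 at *
    generalize σ (σ s) = s2 at *
    generalize σ s = s1 at *
    have l : (1 ^ 2 + s ^ 2) * s1 ^ 2 * (Z / (Z + 1)) + s ^ 2 * (1 ^ 2 + s1 ^ 2) * ((Z + 1) / Z) =
        ((s + s1) * Z + s * (1 + s1)) ^ 2 / (Z ^ 2 + Z) := by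
      have : Z ^ 2 + Z = Z * (Z + 1) := by ring
      rw [this]
      field_simp
      clear * - h2
      grind
    have r : (1 ^ 2 + s2 ^ 2) * (1 ^ 2 + s3 ^ 2) * (Z2 / (Z2 + 1)) +
        s2 ^ 2 * s3 ^ 2 * ((Z2 + 1) / Z2) =
        ((1 + s2 + s3) * Z2 + s2 * s3) ^ 2 / (Z2 ^ 2 + Z2) := by
      have : Z2 ^ 2 + Z2 = Z2 * (Z2 + 1) := by ring
      rw [this]
      field_simp
      clear * - h2
      grind
    rw [l, r]
    have hX : Z ^ 2 + Z ≠ 0 := by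
      have : Z ^ 2 + Z = Z * (Z + 1) := by ring
      rw [this]
      exact mul_ne_zero hZ0 hZ1
    have hX2 : Z2 ^ 2 + Z2 ≠ 0 := by
      have : Z2 ^ 2 + Z2 = Z2 * (Z2 + 1) := by ring
      rw [this]
      exact mul_ne_zero hZ02 hZ6
    rw [div_mul_div_comm, div_mul_div_comm, div_eq_div_iff (mul_ne_zero hX hZ03)
      (mul_ne_zero hZ5 hX2)]
    linear_combination key

theorem exists_multiplier {e q : ℕ} (he : 0 < e) (hq : q = 2 ^ e)
    (hcard : Fintype.card K = q ^ 8) (σ : K →+* K)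
    (h8 : ∀ x, σ (σ (σ (σ (σ (σ (σ (σ x))))))) = x) (hfix : ∀ x, σ x = x ↔ x ^ q = x)
    {s : K} (hs : σ (σ (σ (σ s))) = s) (hs0 : s ≠ 0) (hs1 : s ≠ 1) :
    ∃ a, a * σ (σ (σ (σ a))) = 1 ∧
      ((1 + s) * σ s * a + s * (1 + σ s) * σ (σ (σ (σ a)))) *
        σ (σ (σ (σ (σ (σ (σ a)))))) =
      σ a * ((1 + σ (σ s)) * (1 + σ (σ (σ s))) * σ (σ a) +
        σ (σ s) * σ (σ (σ s)) * σ (σ (σ (σ (σ (σ a)))))) := by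
  by_cases hn : 1 + s + σ s + σ (σ s) + σ (σ (σ s)) = 0
  · refine ⟨1, by simp, ?_⟩
    have h2 : (2 : K) = 0 := CharTwo.two_eq_zero
    simp only [map_one]
    linear_combination (norm := skip) hn
    clear * - h2
    grind
  · obtain ⟨Y, Z, h⟩ := exists_isSolution he hq hcard σ h8 hfix hs hs0 hs1 (inv_mul_cancel₀ hn)
    exact h.exists_multiplier hs hs0 hs1 (inv_mul_cancel₀ hn)

end Multiplier

section Nilpotent

/-- The additive map `x ↦ A * σ x + B * σ⁵ x + x`. -/
def binomialAddHom {K : Type*} [Field K] (σ : K →+* K) (A B : K) : K →+ K :=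
  (AddMonoidHom.mulLeft A).comp σ.toAddMonoidHom +
    (AddMonoidHom.mulLeft B).comp
      (σ.comp (σ.comp (σ.comp (σ.comp σ)))).toAddMonoidHom + AddMonoidHom.id K

theorem binomialAddHom_apply {K : Type*} [Field K] (σ : K →+* K) (A B x : K) :
    binomialAddHom σ A B x = A * σ x + B * σ (σ (σ (σ (σ x)))) + x := rfl

variable {K : Type*} [Field K] [CharP K 2]

theorem binomialAddHom_iterate (σ : K →+* K)
    (h8 : ∀ x, σ (σ (σ (σ (σ (σ (σ (σ x))))))) = x) {A B : K}
    (hP : A * σ (σ (σ (σ A))) + B * σ (σ (σ (σ B))) = 1)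
    (hQ : A * σ B + B * σ (σ (σ (σ (σ A)))) =
      σ (σ (A * σ A + B * σ (σ (σ (σ (σ B))))))) (x : K) :
    (binomialAddHom σ A B)^[4] x = 0 := by
  have h2 : (2 : K) = 0 := CharTwo.two_eq_zero
  obtain ⟨P, hPdef⟩ : ∃ P, P = A * σ A + B * σ (σ (σ (σ (σ B)))) := ⟨_, rfl⟩
  have key : P * σ (σ (σ (σ P))) + σ (σ P) * σ (σ (σ (σ (σ (σ P))))) = 1 := by
    have hP' := congrArg σ hP
    rw [← hPdef] at hQ
    have h4 : σ (σ (σ (σ P))) = σ (σ (σ (σ A))) * σ (σ (σ (σ (σ A)))) +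
        σ (σ (σ (σ B))) * σ B := by
      simp only [hPdef, map_mul, map_add, h8]
    have h6 := congrArg (fun x => σ (σ (σ (σ x)))) hQ
    simp only [map_mul, map_add, map_one, h8] at hP' h6
    rw [← h6, h4, ← hQ, hPdef]
    linear_combination hP + (A * σ (σ (σ (σ A))) + B * σ (σ (σ (σ B)))) * hP' +
      (A * σ A * σ B * σ (σ (σ (σ B))) +
        B * σ (σ (σ (σ A))) * σ (σ (σ (σ (σ A)))) * σ (σ (σ (σ (σ B))))) * h2
  have sq : ∀ x, binomialAddHom σ A B (binomialAddHom σ A B x) =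
      P * σ (σ x) + σ (σ P) * σ (σ (σ (σ (σ (σ x))))) + x := by
    intro x
    simp only [binomialAddHom_apply, map_mul, map_add, h8]
    rw [hPdef, ← hQ]
    linear_combination (A * σ x + B * σ (σ (σ (σ (σ x))))) * h2
  simp only [Function.iterate_succ, Function.iterate_zero, Function.comp_apply, id_eq]
  simp only [sq, map_mul, map_add, h8]
  linear_combination x * key + (x + P * σ (σ x) + σ (σ P) * σ (σ (σ (σ (σ (σ x))))) +
    P * σ (σ P) * σ (σ (σ (σ x)))) * h2

theorem exists_coefficients [Fintype K] {e q : ℕ} (he : 0 < e) (hq : q = 2 ^ e)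
    (hcard : Fintype.card K = q ^ 8) (σ : K →+* K)
    (h8 : ∀ x, σ (σ (σ (σ (σ (σ (σ (σ x))))))) = x) (hfix : ∀ x, σ x = x ↔ x ^ q = x)
    {δ : K} (hδ : δ ≠ 0) (hδ1 : δ * σ (σ (σ (σ δ))) ≠ 1) :
    ∃ A, A ≠ 0 ∧ ∀ x, (binomialAddHom σ A (δ * A))^[4] x = 0 := by
  have h2 : (2 : K) = 0 := CharTwo.two_eq_zero
  obtain ⟨d, hd⟩ : ∃ d, d = δ * σ (σ (σ (σ δ))) := ⟨_, rfl⟩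
  rw [← hd] at hδ1
  have hσd : σ (σ (σ (σ d))) = d := by rw [hd]; simp only [map_mul, h8, mul_comm]
  have hd0 : d ≠ 0 := by rw [hd]; simp [hδ]
  have hd1 : 1 + d ≠ 0 := fun h => hδ1 (CharTwo.add_eq_zero.1 h).symm
  obtain ⟨s, hs⟩ := FiniteField.isSquare_of_char_two (ringChar.eq K 2) (d / (1 + d))
  rw [← sq] at hs
  have hs4 : σ (σ (σ (σ s))) = s := by
    apply CharTwo.sq_injective
    change σ (σ (σ (σ s))) ^ 2 = s ^ 2
    simp only [← map_pow, ← hs]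
    simp [hσd]
  have hs0 : s ≠ 0 := by
    rintro rfl
    simp [hd0, hd1] at hs
  have hs' : d = s ^ 2 * (1 + d) := by rw [← hs]; field_simp
  have hs1 : s ≠ 1 := by
    rintro rfl
    simp at hs'
  have hs1' : 1 + s ≠ 0 := fun h => hs1 (CharTwo.add_eq_zero.1 h).symm
  obtain ⟨n, hn⟩ := FiniteField.isSquare_of_char_two (ringChar.eq K 2) (δ * (1 + s) / s)
  rw [← sq, div_eq_iff hs0] at hn
  have hn4 : n * σ (σ (σ (σ n))) = 1 := by
    have h := congrArg (fun x => σ (σ (σ (σ x)))) hn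
    simp only [map_mul, map_add, map_one, map_pow, hs4] at h
    apply CharTwo.sq_injective
    change (_) ^ 2 = 1 ^ 2
    refine mul_right_cancel₀ (pow_ne_zero 2 hs0) ?_
    have : (n * σ (σ (σ (σ n)))) ^ 2 * s ^ 2 = (n ^ 2 * s) * (σ (σ (σ (σ n))) ^ 2 * s) := by ring
    rw [this, ← hn, ← h]
    linear_combination -(1 + s) ^ 2 * hd + hs' + (s * d + s ^ 2 * d) * h2
  obtain ⟨a, ha, hstar⟩ := exists_multiplier he hq hcard σ h8 hfix hs4 hs0 hs1
  have ha0 : a ≠ 0 := left_ne_zero_of_mul_eq_one ha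
  have hn0 : n ≠ 0 := left_ne_zero_of_mul_eq_one hn4
  obtain ⟨A, hA⟩ : ∃ A, A = (1 + s) * σ (σ (σ (σ (σ (σ (σ (a * n))))))) * σ (σ (σ (σ n))) :=
    ⟨_, rfl⟩
  have hB : δ * A = s * σ (σ (σ (σ (σ (σ (σ (a * n))))))) * n := by
    rw [hA]
    linear_combination σ (σ (σ (σ (σ (σ (σ (a * n))))))) *
      (σ (σ (σ (σ n))) * hn + n * s * hn4)
  have ha3 := congrArg (fun x => σ (σ (σ x))) ha
  have hn3 := congrArg (fun x => σ (σ (σ x))) hn4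
  have hn2 := congrArg (fun x => σ (σ x)) hn4
  simp only [map_mul, map_one] at ha3 hn3 hn2
  refine ⟨A, ?_, binomialAddHom_iterate σ h8 ?_ ?_⟩
  · rw [hA]
    exact mul_ne_zero (mul_ne_zero hs1' (by simp [ha0, hn0])) (by simpa using hn0)
  · rw [hB, hA]
    simp only [map_mul, map_add, map_one, h8, hs4]
    clear * - h2 ha3 hn3 hn4
    generalize σ (σ (σ (σ (σ (σ (σ n)))))) = n7 at *
    generalize σ (σ (σ (σ (σ (σ (σ a)))))) = a7 at *
    generalize σ (σ (σ a)) = a3 at *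
    generalize σ (σ (σ n)) = n3 at *
    generalize σ n3 = n4 at *
    linear_combination ((1 + s) ^ 2 + s ^ 2) * (a3 * a7 * n3 * n7 * hn4 + a3 * a7 * hn3 + ha3) +
      (s + s ^ 2) * h2
  · rw [hB, hA]
    simp only [map_mul, map_add, map_one, h8, hs4]
    clear * - h2 hstar hn2 hn4
    generalize σ (σ (σ (σ (σ (σ (σ n)))))) = n7 at *
    generalize σ (σ (σ (σ (σ (σ (σ a)))))) = a7 at *
    generalize σ (σ (σ (σ (σ (σ a))))) = a6 at *
    generalize σ (σ (σ (σ (σ (σ n))))) = n6 at *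
    generalize σ (σ (σ (σ n))) = n4 at *
    generalize σ (σ (σ (σ a))) = a4 at *
    generalize σ (σ (σ s)) = s3 at *
    generalize σ (σ a) = a2 at *
    generalize σ (σ s) = s2 at *
    generalize σ (σ n) = n2 at *
    generalize σ a = a1 at *
    generalize σ s = s1 at *
    generalize σ n = n1 at *
    linear_combination n7 * n1 * hstar +
      n7 * n1 * a7 * ((1 + s) * s1 * a + s * (1 + s1) * a4) * hn4 -
      n7 * n1 * a1 * ((1 + s2) * (1 + s3) * a2 + s2 * s3 * a6) * hn2

end Nilpotent

section Scattered

theorem not_isScattered_of_iterate {K : Type*} [Field K] [Fintype K] {q : ℕ} (hq : 1 < q)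
    (hcard : Fintype.card K = q ^ 8) {f : K → K} (m : K →+ K) (h : ∀ x, m^[4] x = 0) (c : K)
    (hc : ∀ x, m x = 0 → f x = c * x) : ¬ IsScattered q f := by
  classical
  intro hf
  have h1 := card_le_card_ker_pow m 4 h
  rw [hcard, show 8 = 2 * 4 by norm_num, pow_mul] at h1
  have h2 : q ^ 2 ≤ #{x | m x = 0} := (Nat.pow_le_pow_iff_left (by norm_num)).1 h1
  have h3 : q < q ^ 2 := by nlinarith
  obtain ⟨x₀, hx₀, hne⟩ := Finset.exists_mem_ne (hq.trans (h3.trans_le h2)) 0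
  have hx₀' : m x₀ = 0 := (Finset.mem_filter.1 hx₀).2
  have h4 : #{x | m x = 0} ≤ #{x : K | x ^ q = x} := by
    refine Finset.card_le_card_of_injOn (fun x => x / x₀) ?_ ?_
    · intro x hx
      have hx' : m x = 0 := (Finset.mem_filter.1 hx).2
      refine Finset.mem_filter.2 ⟨Finset.mem_univ _, ?_⟩
      rcases eq_or_ne x 0 with rfl | hx0
      · simp [show q ≠ 0 by omega]
      · refine hf x x₀ hx0 hne ?_
        rw [hc x hx', hc x₀ hx₀', mul_div_cancel_right₀ _ hx0, mul_div_cancel_right₀ _ hne]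
    · intro x _ y _ hxy
      exact (div_left_inj' hne).1 hxy
  have h5 := card_pow_eq_self_le (K := K) hq
  omega

/-- The additive map `x ↦ A * σ⁴ x + x`. -/
def monomialAddHom {K : Type*} [Field K] (σ : K →+* K) (A : K) : K →+ K :=
  (AddMonoidHom.mulLeft A).comp (σ.comp (σ.comp (σ.comp σ))).toAddMonoidHom + AddMonoidHom.id K

theorem monomialAddHom_apply {K : Type*} [Field K] (σ : K →+* K) (A x : K) :
    monomialAddHom σ A x = A * σ (σ (σ (σ x))) + x := rfl

variable {K : Type*} [Field K] [Fintype K] [CharP K 2]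

theorem not_isScattered_binomial {e q : ℕ} (he : 0 < e) (hq : q = 2 ^ e)
    (hcard : Fintype.card K = q ^ 8) (σ : K →+* K)
    (h8 : ∀ x, σ (σ (σ (σ (σ (σ (σ (σ x))))))) = x) (hfix : ∀ x, σ x = x ↔ x ^ q = x)
    {δ : K} (hδ : δ ≠ 0) : ¬ IsScattered q fun x => σ x + δ * σ (σ (σ (σ (σ x)))) := by
  have h2 : (2 : K) = 0 := CharTwo.two_eq_zero
  have hq1 : 1 < q := by rw [hq]; exact Nat.one_lt_two_pow (by omega)
  by_cases hδ1 : δ * σ (σ (σ (σ δ))) = 1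
  · refine not_isScattered_of_iterate hq1 hcard
      (monomialAddHom σ (σ (σ (σ (σ (σ (σ (σ δ)))))))) (fun x => ?_) 0 fun x hx => ?_
    · have h3 := congrArg (fun x => σ (σ (σ x))) hδ1
      simp only [map_mul, map_one] at h3
      have hsq : ∀ x, monomialAddHom σ (σ (σ (σ (σ (σ (σ (σ δ)))))))
          (monomialAddHom σ (σ (σ (σ (σ (σ (σ (σ δ))))))) x) = 0 := by
        intro x
        simp only [monomialAddHom_apply, map_add, map_mul, h8]
        linear_combination x * h3 +
          (x + σ (σ (σ (σ (σ (σ (σ δ)))))) * σ (σ (σ (σ x)))) * h2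
      simp only [Function.iterate_succ, Function.iterate_zero, Function.comp_apply, id_eq]
      exact hsq _
    · rw [monomialAddHom_apply] at hx
      have h := congrArg σ hx
      simp only [map_mul, map_add, map_zero, h8] at h
      linear_combination h
  · obtain ⟨A, hA, hm⟩ := exists_coefficients he hq hcard σ h8 hfix hδ hδ1
    refine not_isScattered_of_iterate hq1 hcard _ hm A⁻¹ fun x hx => ?_
    rw [binomialAddHom_apply] at hx
    refine mul_left_cancel₀ hA ?_
    rw [mul_inv_cancel_left₀ hA]
    linear_combination hx - x * h2

end Scattered

theorem pow_pow_mod_eight {K : Type*} [Field K] [Fintype K] {q : ℕ}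
    (hcard : Fintype.card K = q ^ 8) (k : ℕ) (x : K) : x ^ q ^ (k % 8) = x ^ q ^ k := by
  conv_rhs => rw [← Nat.mod_add_div k 8, pow_add, pow_mul, pow_mul, ← hcard,
    FiniteField.pow_card_pow]

theorem pow_pow_of_pow_eq_self {K : Type*} [Monoid K] {q : ℕ} {x : K} (h : x ^ q = x) (k : ℕ) :
    x ^ q ^ k = x := by
  induction k with
  | zero => simp
  | succ k ih => rw [pow_succ, pow_mul, ih, h]

/-- For `q` an even prime power with `q ≥ 162019556021`, every `1 ≤ s ≤ 7` and every nonzero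
`δ ∈ F_{q^8}`, the binomial `x ^ q ^ s + δ x ^ q ^ ((s + 4) % 8)` is not scattered over
`F_{q^8}`. -/
theorem stmt_3 (e : ℕ) (he : 0 < e) (q : ℕ) (hq : q = 2 ^ e)
    (hqbig : 162019556021 ≤ q)
    (F : Type*) [Field F] [Fintype F] (hcard : Fintype.card F = q ^ 8)
    (s : ℕ) (hs1 : 1 ≤ s) (hs7 : s ≤ 7) (δ : F) (hδ : δ ≠ 0) :
    ¬ IsScattered q (fun x : F => x ^ q ^ s + δ * x ^ q ^ ((s + 4) % 8)) := by
  have hchar : CharP F 2 := by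
    refine charP_of_card_eq_prime_pow (f := e * 8) ?_
    rw [hcard, hq, pow_mul]
  have hfrob : ∀ k (x : F), iterateFrobenius F 2 (e * k) x = x ^ q ^ k := fun k x => by
    rw [iterateFrobenius_def, hq, pow_mul]
  rcases Nat.even_or_odd s with hs | ⟨t, ht⟩
  · have h2 : (2 : F) = 0 := CharTwo.two_eq_zero
    have hτ4 : ∀ x : F, (((x ^ q ^ 2) ^ q ^ 2) ^ q ^ 2) ^ q ^ 2 = x := fun x => by
      rw [← pow_mul, ← pow_mul, ← pow_mul, ← pow_add, ← pow_add, ← pow_add,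
        ← pow_pow_mod_eight hcard]
      simp
    refine not_isScattered_of_iterate (by omega) hcard
      (addSelfHom (iterateFrobenius F 2 (e * 2))) (fun x => ?_) (1 + δ) fun x hx => ?_
    · have hsq : ∀ x, addSelfHom (iterateFrobenius F 2 (e * 2))
          (addSelfHom (iterateFrobenius F 2 (e * 2)) x) = (x ^ q ^ 2) ^ q ^ 2 + x := by
        intro x
        simp only [addSelfHom_apply, map_add, hfrob]
        linear_combination x ^ q ^ 2 * h2
      simp only [Function.iterate_succ, Function.iterate_zero, Function.comp_apply, id_eq]
      rw [hsq, hsq]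
      simp only [← hfrob, map_add]
      simp only [hfrob, hτ4]
      linear_combination (x + (x ^ q ^ 2) ^ q ^ 2) * h2
    · rw [addSelfHom_eq_zero, hfrob] at hx
      have hev : ∀ k, Even k → x ^ q ^ k = x := by
        rintro k ⟨j, rfl⟩
        rw [← two_mul, pow_mul]
        exact pow_pow_of_pow_eq_self hx j
      have hs4 : Even ((s + 4) % 8) := by
        rw [Nat.even_iff] at hs ⊢
        omega
      simp only [hev s hs, hev _ hs4]
      ring
  · have hcomp : ∀ a b (x : F), (x ^ q ^ a) ^ q ^ b = x ^ q ^ (a + b) := fun a b x => by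
      rw [← pow_mul, ← pow_add]
    have h := not_isScattered_binomial he hq hcard (iterateFrobenius F 2 (e * s))
      (fun x => ?_) (fun x => ?_) hδ
    · convert h using 4 with x
      · rw [hfrob]
      · simp only [hfrob, hcomp]
        rw [← pow_pow_mod_eight hcard (_ + s)]
        congr 3
        omega
    · simp only [hfrob, hcomp]
      rw [← pow_pow_mod_eight hcard, show (s + s + s + s + s + s + s + s) % 8 = 0 by omega]
      simp
    · rw [hfrob]
      refine ⟨fun h => ?_, fun h => pow_pow_of_pow_eq_self h s⟩
      have h1 := pow_pow_of_pow_eq_self h s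
      rw [← pow_mul, ← pow_pow_mod_eight hcard] at h1
      have : s * s % 8 = 1 := by
        interval_cases s <;> omega
      rwa [this, pow_one] at h1
end

section
/- Let q be a prime power, n a positive integer, 0 < I < J < n, and α ∈ F_{q^n}. The binomial f(x) = x^{q^I} + α x^{q^J} is scattered over F_{q^n} if and only if there is no pair (x, y) ∈ F_{q^n}^2 with x ∉ F_q, y ≠ 0, and (x − x^{q^I}) + α·y^{q^J − q^I}·(x − x^{q^J}) = 0. -/
/-- For `x = t * y`, the slopes `(x ^ a + α x ^ b) / x` and `(y ^ a + α y ^ b) / y` agree exactly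
when `(t - t ^ a) + α y ^ (b - a) (t - t ^ b) = 0`. -/
lemma binomial_div_eq_iff {F : Type*} [Field F] {a b : ℕ} (hab : a ≤ b) (α : F) {t y : F}
    (ht : t ≠ 0) (hy : y ≠ 0) :
    ((t * y) ^ a + α * (t * y) ^ b) / (t * y) = (y ^ a + α * y ^ b) / y ↔
      (t - t ^ a) + α * y ^ (b - a) * (t - t ^ b) = 0 := by
  have hb : y ^ b = y ^ a * y ^ (b - a) := by rw [← pow_add, Nat.add_sub_cancel' hab]
  rw [div_eq_div_iff (mul_ne_zero ht hy) hy, mul_pow, mul_pow, hb]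
  have hne : y ^ a * y ≠ 0 := mul_ne_zero (pow_ne_zero a hy) hy
  constructor
  · intro h
    refine (mul_eq_zero.mp ?_).resolve_left hne
    linear_combination -h
  · intro h
    linear_combination -(y ^ a * y) * h

/-- The binomial `x ^ q ^ I + α x ^ q ^ J` is scattered over `F_{q^n}` iff there is no pair
`(x, y)` with `x ∉ F_q` (i.e. `x ^ q ≠ x`), `y ≠ 0`, and
`(x - x ^ q ^ I) + α y ^ (q ^ J - q ^ I) (x - x ^ q ^ J) = 0`. -/
theorem stmt_5 (p e : ℕ) (hp : p.Prime) (he : 0 < e) (q : ℕ) (hq : q = p ^ e)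
    (n : ℕ) (hn : 0 < n) (I J : ℕ) (hI : 0 < I) (hIJ : I < J) (hJ : J < n)
    (F : Type*) [Field F] [Fintype F] (hcard : Fintype.card F = q ^ n)
    (α : F) :
    IsScattered q (fun x : F => x ^ q ^ I + α * x ^ q ^ J) ↔
      ¬ ∃ x y : F, x ^ q ≠ x ∧ y ≠ 0 ∧
          (x - x ^ q ^ I) + α * y ^ (q ^ J - q ^ I) * (x - x ^ q ^ J) = 0 := by
  have hq0 : 0 < q := hq ▸ pow_pos hp.pos e
  have hpow : q ^ I ≤ q ^ J := Nat.pow_le_pow_right hq0 hIJ.le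
  constructor
  · rintro h ⟨t, y, ht, hy, heq⟩
    have ht0 : t ≠ 0 := by
      rintro rfl
      exact ht (zero_pow hq0.ne')
    have hfix := h (t * y) y (mul_ne_zero ht0 hy) hy
      ((binomial_div_eq_iff hpow α ht0 hy).mpr heq)
    rw [mul_div_cancel_right₀ t hy] at hfix
    exact ht hfix
  · intro h x y hx hy heq
    by_contra hne
    refine h ⟨x / y, y, hne, hy, (binomial_div_eq_iff hpow α (div_ne_zero hx hy) hy).mp ?_⟩
    rw [div_mul_cancel₀ x hy]
    exact heq
end

section
/- Let K be a field, n ≥ 3 an integer, and I, J integers with 1 ≤ I, J ≤ n−1 and I ≠ J. In the polynomial ring K[X_0, …, X_{n−1}], the polynomials F_I := ∏_{ℓ=0}^{n−1}(X_ℓ − X_{(ℓ+I) mod n}) and F_J := ∏_{ℓ=0}^{n−1}(X_ℓ − X_{(ℓ+J) mod n}) differ by a nonzero scalar factor (i.e., F_I = c·F_J for some c ∈ K ∖ {0}) if and only if I + J = n. -/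
open MvPolynomial

/-- Two cyclic difference products over `ZMod n` with steps `a` and `b`, where `b ≠ 0`, can only
be proportional if `a = b` or `a + b = 0`. -/
theorem eq_or_add_eq_zero_of_prod_X_sub_X_eq {K : Type*} [Field K] {n : ℕ} [NeZero n]
    {a b : ZMod n} (hb : b ≠ 0) {c : K} (hc : c ≠ 0)
    (h : (∏ ℓ : ZMod n, (X ℓ - X (ℓ + a)) : MvPolynomial (ZMod n) K)
      = C c * ∏ ℓ : ZMod n, (X ℓ - X (ℓ + b))) :
    a = b ∨ a + b = 0 := by
  have h' := congrArg (rename (R := K) fun k : ZMod n => if k = a then 0 else k) h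
  simp only [map_mul, map_prod, map_sub, rename_X, rename_C] at h'
  rw [Finset.prod_eq_zero (Finset.mem_univ (0 : ZMod n)) (by simp), eq_comm, mul_eq_zero,
    or_iff_right (by simpa using hc), Finset.prod_eq_zero_iff] at h'
  obtain ⟨ℓ, -, hℓ⟩ := h'
  have hℓ := X_injective (sub_eq_zero.mp hℓ)
  split_ifs at hℓ with h1 h2 h2
  · exact absurd (by simpa [h1] using h2) hb
  · exact Or.inr (h1 ▸ hℓ.symm)
  · exact Or.inl (by rw [← h2, hℓ, zero_add])
  · exact absurd (by simpa using hℓ) hb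

/-- Cyclic difference products over `ZMod n` with opposite steps agree up to sign. -/
theorem prod_X_sub_X_eq_of_add_eq_zero (K : Type*) [Field K] {n : ℕ} [NeZero n]
    {a b : ZMod n} (h : a + b = 0) :
    (∏ ℓ : ZMod n, (X ℓ - X (ℓ + a)) : MvPolynomial (ZMod n) K)
      = C ((-1) ^ n) * ∏ ℓ : ZMod n, (X ℓ - X (ℓ + b)) := by
  rw [← Equiv.prod_comp (Equiv.addRight b)]
  have hba : ∀ ℓ : ZMod n, ℓ + b + a = ℓ := fun ℓ => by rw [add_assoc, add_comm b, h, add_zero]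
  simp only [Equiv.coe_addRight, hba]
  rw [← Finset.prod_congr rfl fun ℓ _ => neg_sub (X ℓ : MvPolynomial (ZMod n) K) (X (ℓ + b)),
    Finset.prod_neg, Finset.card_univ, ZMod.card]
  simp

/-- In `K[X_0, …, X_{n-1}]` (variables indexed by `ZMod n`, so that indices are taken
modulo `n`), for `1 ≤ I, J ≤ n - 1` with `I ≠ J`, the polynomials
`F_I = ∏_ℓ (X_ℓ - X_{ℓ+I})` and `F_J = ∏_ℓ (X_ℓ - X_{ℓ+J})` differ by a nonzero scalar
factor iff `I + J = n`. -/
theorem stmt_6 (K : Type*) [Field K] (n : ℕ) [NeZero n] (hn : 3 ≤ n)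
    (I J : ℕ) (hI1 : 1 ≤ I) (hI : I ≤ n - 1) (hJ1 : 1 ≤ J) (hJ : J ≤ n - 1)
    (hIJ : I ≠ J) :
    (∃ c : K, c ≠ 0 ∧
        (∏ ℓ : ZMod n, (X ℓ - X (ℓ + (I : ZMod n))) : MvPolynomial (ZMod n) K)
          = C c * ∏ ℓ : ZMod n, (X ℓ - X (ℓ + (J : ZMod n)))) ↔
      I + J = n := by
  constructor
  · rintro ⟨c, hc, h⟩
    have hJ0 : (J : ZMod n) ≠ 0 := by
      rw [Ne, ZMod.natCast_eq_zero_iff]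
      exact Nat.not_dvd_of_pos_of_lt (by omega) (by omega)
    rcases eq_or_add_eq_zero_of_prod_X_sub_X_eq hJ0 hc h with h | h
    · rw [ZMod.natCast_eq_natCast_iff', Nat.mod_eq_of_lt (by omega),
        Nat.mod_eq_of_lt (by omega)] at h
      exact absurd h hIJ
    · rw [← Nat.cast_add, ZMod.natCast_eq_zero_iff] at h
      exact Nat.eq_of_dvd_of_lt_two_mul (by omega) h (by omega)
  · intro h
    refine ⟨(-1) ^ n, by simp, prod_X_sub_X_eq_of_add_eq_zero K ?_⟩
    rw [← Nat.cast_add, h, ZMod.natCast_self]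
end

section
/- Let K be a field, n ≥ 5 an integer, and I, J integers with 1 ≤ I < J ≤ n−1 and I + J ≠ n, and let A ∈ K ∖ {0}. Write F_1 := ∏_{ℓ=0}^{n−1}(X_ℓ − X_{(ℓ+I) mod n}) = (X_0 − X_I)(X_{n−I} − X_0)·G and F_2 := ∏_{ℓ=0}^{n−1}(X_ℓ − X_{(ℓ+J) mod n}) = (X_0 − X_J)(X_{n−J} − X_0)·H, where G := ∏_{ℓ ∉ {0, n−I}}(X_ℓ − X_{(ℓ+I) mod n}) and H := ∏_{ℓ ∉ {0, n−J}}(X_ℓ − X_{(ℓ+J) mod n}) lie in K[X_1, …, X_{n−1}]. Then the three polynomials a := H − A·G, b := A·G·(X_I + X_{n−I}) − H·(X_J + X_{n−J}), and c := H·X_J·X_{n−J} − A·G·X_I·X_{n−I} have no non-constant common factor in K[X_1, …, X_{n−1}]. -/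
open MvPolynomial

namespace MvPolynomial

variable {σ K : Type*} [Field K]

theorem irreducible_X_sub_X {a b : σ} (h : a ≠ b) :
    Irreducible (X a - X b : MvPolynomial σ K) := by
  classical
  set c : σ →₀ K := Finsupp.single a 1 - Finsupp.single b 1 with hc
  have hca : c a = 1 := by simp [hc, h.symm]
  have key : sumSMulX c = (X a - X b : MvPolynomial σ K) := by simp [hc, sumSMulX]
  rw [← key]
  refine irreducible_sumSMulX _ ⟨a, by simp [hca]⟩ fun r hr => ?_
  exact isUnit_of_dvd_one (hca ▸ hr a)

theorem eq_or_eq_of_X_sub_X_dvd {a b c e : σ}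
    (h : (X a - X b : MvPolynomial σ K) ∣ X c - X e) (hce : c ≠ e) :
    (c = a ∧ e = b) ∨ (c = b ∧ e = a) := by
  classical
  have mem : ∀ t : σ, t = c ∨ t = e → t = a ∨ t = b := by
    intro t ht
    by_contra! hne
    have hd := map_dvd (eval (Pi.single t (1 : K))) h
    rcases ht with rfl | rfl
    · simp [hne.1.symm, hne.2.symm, hce.symm] at hd
    · simp [hne.1.symm, hne.2.symm, hce] at hd
  rcases mem c (Or.inl rfl) with rfl | rfl <;> rcases mem e (Or.inr rfl) with rfl | rfl <;>
    simp_all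

theorem X_sub_X_dvd_of_irreducible_of_dvd {a b : σ} {p q : MvPolynomial σ K} (hab : a ≠ b)
    (hp : Irreducible p) (h : p ∣ X a - X b) (hq : p ∣ q) : X a - X b ∣ q :=
  (hp.dvd_symm (irreducible_X_sub_X hab) h).trans hq

/-- Two disjoint pairs of variables, the first one consisting of distinct variables, have no
common irreducible factor between their difference of sums and their difference of products. -/
theorem not_dvd_sum_sub_of_dvd_mul_sub {x y u v : σ} (hxy : x ≠ y) (hxu : x ≠ u) (hxv : x ≠ v)
    (hyu : y ≠ u) (hyv : y ≠ v) {p : MvPolynomial σ K} (hp : Irreducible p)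
    (hs : p ∣ X x + X y - (X u + X v)) (hq : p ∣ X u * X v - X x * X y) : False := by
  have hprod : p ∣ (X x - X u) * (X x - X v) := by
    have := dvd_add (hs.mul_left (X x)) hq
    convert this using 1
    ring
  have aux : ∀ u v : σ, x ≠ u → y ≠ u → y ≠ v → p ∣ X x + X y - (X u + X v) →
      p ∣ X x - X u → False := by
    intro u v hxu hyu hyv hs h
    have hd : (X x - X u : MvPolynomial σ K) ∣ X y - X v := by
      refine X_sub_X_dvd_of_irreducible_of_dvd hxu hp h ?_
      convert dvd_sub hs h using 1
      ring
    rcases eq_or_eq_of_X_sub_X_dvd hd hyv with h' | h'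
    · exact hxy h'.1.symm
    · exact hyu h'.1
  rcases hp.prime.dvd_or_dvd hprod with h | h
  · exact aux u v hxu hyu hyv hs h
  · exact aux v u hxv hyv hyu (by rwa [add_comm (X v)]) h

end MvPolynomial

/-- In `K[X_0, …, X_{n-1}]` (variables indexed by `ZMod n`, indices taken modulo `n`), with
`F_1 = ∏_ℓ (X_ℓ - X_{ℓ+I}) = (X_0 - X_I)(X_{n-I} - X_0) G` and
`F_2 = ∏_ℓ (X_ℓ - X_{ℓ+J}) = (X_0 - X_J)(X_{n-J} - X_0) H`, the three polynomials
`a = H - A G`, `b = A G (X_I + X_{n-I}) - H (X_J + X_{n-J})` and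
`c = H X_J X_{n-J} - A G X_I X_{n-I}` have no non-constant common factor. -/
theorem stmt_7 (K : Type*) [Field K] (n : ℕ) [NeZero n] (hn : 5 ≤ n)
    (I J : ℕ) (hI : 1 ≤ I) (hIJ : I < J) (hJ : J ≤ n - 1) (hsum : I + J ≠ n)
    (A : K) (hA : A ≠ 0) :
    ∀ G H : MvPolynomial (ZMod n) K,
      G = ∏ ℓ ∈ Finset.univ \ {(0 : ZMod n), ((n - I : ℕ) : ZMod n)},
            (X ℓ - X (ℓ + (I : ZMod n))) →
      H = ∏ ℓ ∈ Finset.univ \ {(0 : ZMod n), ((n - J : ℕ) : ZMod n)},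
            (X ℓ - X (ℓ + (J : ZMod n))) →
      ∀ d : MvPolynomial (ZMod n) K,
        d ∣ H - C A * G →
        d ∣ C A * G * (X (I : ZMod n) + X ((n - I : ℕ) : ZMod n))
              - H * (X (J : ZMod n) + X ((n - J : ℕ) : ZMod n)) →
        d ∣ H * X (J : ZMod n) * X ((n - J : ℕ) : ZMod n)
              - C A * G * X (I : ZMod n) * X ((n - I : ℕ) : ZMod n) →
        d.totalDegree = 0 := by
  rintro G H rfl rfl d ha hb hc
  set G := ∏ ℓ ∈ Finset.univ \ {(0 : ZMod n), ((n - I : ℕ) : ZMod n)},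
    (X ℓ - X (ℓ + (I : ZMod n)) : MvPolynomial (ZMod n) K)
  set H := ∏ ℓ ∈ Finset.univ \ {(0 : ZMod n), ((n - J : ℕ) : ZMod n)},
    (X ℓ - X (ℓ + (J : ZMod n)) : MvPolynomial (ZMod n) K)
  have cast_ne : ∀ k l : ℕ, k < n → l < n → k ≠ l → (k : ZMod n) ≠ l := by
    intro k l hk hl hkl h
    rw [ZMod.natCast_eq_natCast_iff'] at h
    rw [Nat.mod_eq_of_lt hk, Nat.mod_eq_of_lt hl] at h
    exact hkl h
  have hI0 : (I : ZMod n) ≠ 0 := by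
    simpa using cast_ne I 0 (by lia) (by lia) (by lia)
  have hJ0 : (J : ZMod n) ≠ 0 := by
    simpa using cast_ne J 0 (by lia) (by lia) (by lia)
  have hIJ' : (I : ZMod n) ≠ J := cast_ne _ _ (by lia) (by lia) (by lia)
  have hIJn : (I : ZMod n) ≠ (n - J : ℕ) := cast_ne _ _ (by lia) (by lia) (by lia)
  have hInJ : ((n - I : ℕ) : ZMod n) ≠ J := cast_ne _ _ (by lia) (by lia) (by lia)
  have hInJn : ((n - I : ℕ) : ZMod n) ≠ (n - J : ℕ) :=
    cast_ne _ _ (by lia) (by lia) (by lia)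
  have hIJsum : (J : ZMod n) + I ≠ 0 := by
    intro h
    apply hIJn
    rw [Nat.cast_sub (by lia), ZMod.natCast_self]
    linear_combination h
  by_cases hd0 : d = 0
  · simp [hd0]
  by_cases hdu : IsUnit d
  · exact (isUnit_iff_totalDegree_of_isReduced.mp hdu).2
  exfalso
  obtain ⟨p, hp, hpd⟩ := WfDvdMonoid.exists_irreducible_factor hdu hd0
  replace ha := hpd.trans ha
  replace hb := hpd.trans hb
  replace hc := hpd.trans hc
  have hCA : IsUnit (C A : MvPolynomial (ZMod n) K) := (isUnit_iff_ne_zero.mpr hA).map C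
  by_cases hpG : p ∣ G
  · have hpH : p ∣ H := by
      convert dvd_add ha (hpG.mul_left (C A)) using 1
      ring
    obtain ⟨ℓ, -, hℓ⟩ := hp.prime.exists_mem_finset_dvd hpG
    obtain ⟨m, -, hm⟩ := hp.prime.exists_mem_finset_dvd hpH
    have hℓI : ℓ ≠ ℓ + I := by simpa using hI0
    have hmJ : m ≠ m + J := by simpa using hJ0
    rcases eq_or_eq_of_X_sub_X_dvd (X_sub_X_dvd_of_irreducible_of_dvd hℓI hp hℓ hm) hmJ with
      ⟨h1, h2⟩ | ⟨h1, h2⟩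
    · apply hIJ'
      linear_combination h1 - h2
    · apply hIJsum
      linear_combination h2 - h1
  · have cancel : ∀ q : MvPolynomial (ZMod n) K, p ∣ C A * G * q → p ∣ q := by
      intro q h
      rw [mul_assoc, hCA.dvd_mul_left] at h
      exact (hp.prime.dvd_or_dvd h).resolve_left hpG
    have hs : p ∣ X (I : ZMod n) + X ((n - I : ℕ) : ZMod n)
        - (X (J : ZMod n) + X ((n - J : ℕ) : ZMod n)) := by
      apply cancel
      convert dvd_add hb (ha.mul_left (X (J : ZMod n) + X ((n - J : ℕ) : ZMod n))) using 1
      ring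
    have hq : p ∣ X (J : ZMod n) * X ((n - J : ℕ) : ZMod n)
        - X (I : ZMod n) * X ((n - I : ℕ) : ZMod n) := by
      apply cancel
      convert dvd_sub hc (ha.mul_left (X (J : ZMod n) * X ((n - J : ℕ) : ZMod n))) using 1
      ring
    by_cases hIn : I = n - I
    · refine not_dvd_sum_sub_of_dvd_mul_sub (cast_ne J (n - J) ?_ ?_ ?_) hIJ'.symm hInJ.symm
        hIJn.symm hInJn.symm hp (dvd_sub_comm.mp hs) (dvd_sub_comm.mp hq) <;> lia
    · exact not_dvd_sum_sub_of_dvd_mul_sub (cast_ne I (n - I) (by lia) (by lia) hIn) hIJ' hIJn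
        hInJ hInJn hp hs hq
end

section
/- Let K be an algebraically closed field, n ≥ 5 an integer, and I, J integers with 1 ≤ I < J ≤ n−1, I + J < n, and gcd(J − I, n) = 1, and let A ∈ K ∖ {0}. Then the polynomial P := A·∏_{ℓ=0}^{n−1}(X_ℓ − X_{(ℓ+I) mod n}) − ∏_{ℓ=0}^{n−1}(X_ℓ − X_{(ℓ+J) mod n}) is irreducible in K[X_0, …, X_{n−1}]. -/
open MvPolynomial

section Identify

theorem X_sub_X_ne_zero {σ K : Type*} [Field K] {i j : σ} (h : i ≠ j) :
    (X i - X j : MvPolynomial σ K) ≠ 0 :=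
  fun h0 => h (X_injective (sub_eq_zero.mp h0))

variable {σ : Type*} [DecidableEq σ]

/-- The self-map of `σ` that sends `j` to `i` and fixes every other index. -/
def identify (i j : σ) : σ → σ := Function.update id j i

theorem identify_left (i j : σ) : identify i j i = i := by
  unfold identify; by_cases h : i = j <;> simp [Function.update_apply]

theorem identify_right (i j : σ) : identify i j j = i := by simp [identify]

theorem comp_identify {τ : Type*} {i j : σ} {r : σ → τ} (h : r i = r j) :
    r ∘ identify i j = r := by
  funext x
  by_cases hx : x = j
  · subst hx; simp [identify_right, h]
  · simp [identify, hx]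

theorem identify_eq_iff {i j x y : σ} : identify i j x = identify i j y ↔
    x = y ∨ (x = i ∧ y = j) ∨ (x = j ∧ y = i) := by
  simp only [identify, Function.update_apply, id]
  grind

theorem identify_comp_eq_iff {τ : Type*} (r : τ → σ) (i j x y : τ) :
    (identify (r i) (r j) ∘ r) x = (identify (r i) (r j) ∘ r) y ↔
      r x = r y ∨ (r x = r i ∧ r y = r j) ∨ (r x = r j ∧ r y = r i) := identify_eq_iff

theorem identify_ne {G : Type*} [AddCommGroup G] [DecidableEq G] {I J : G}
    (hJ : J ≠ 0) (hIJ : I ≠ J) (hIJ' : I ≠ -J) (a l : G) :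
    identify a (a + I) l ≠ identify a (a + I) (l + J) := by
  rw [Ne, identify_eq_iff]
  rintro (h | ⟨rfl, h⟩ | ⟨rfl, h⟩)
  · exact hJ (by simpa using h)
  · exact hIJ (add_left_cancel h).symm
  · apply hIJ'
    rw [eq_neg_iff_add_eq_zero]
    simpa [add_assoc] using h

variable {K : Type*} [Field K]

theorem X_sub_X_dvd_sub_rename (i j : σ) (f : MvPolynomial σ K) :
    X i - X j ∣ f - rename (identify i j) f := by
  rw [← Ideal.mem_span_singleton, ← Ideal.Quotient.mk_eq_mk_iff_sub_mem]
  have : (Ideal.Quotient.mkₐ K (Ideal.span {(X i - X j : MvPolynomial σ K)})) =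
      (Ideal.Quotient.mkₐ K (Ideal.span {(X i - X j : MvPolynomial σ K)})).comp
        (rename (identify i j)) := by
    ext x
    simp only [AlgHom.comp_apply, rename_X, Ideal.Quotient.mkₐ_eq_mk]
    by_cases hx : x = j
    · subst hx
      rw [identify_right, eq_comm, Ideal.Quotient.mk_eq_mk_iff_sub_mem]
      exact Ideal.mem_span_singleton_self _
    · simp [identify, hx]
  exact DFunLike.congr_fun this f

theorem X_sub_X_dvd_iff {i j : σ} {f : MvPolynomial σ K} :
    X i - X j ∣ f ↔ rename (identify i j) f = 0 := by
  constructor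
  · intro h
    have := map_dvd (rename (R := K) (identify i j)) h
    simpa [identify_left, identify_right] using this
  · intro h
    simpa [h] using X_sub_X_dvd_sub_rename i j f

theorem prime_X_sub_X {i j : σ} (h : i ≠ j) : Prime (X i - X j : MvPolynomial σ K) := by
  refine ⟨X_sub_X_ne_zero h, fun hu => ?_, fun f g hfg => ?_⟩
  · simpa using hu.map (constantCoeff (R := K) (σ := σ))
  · rw [X_sub_X_dvd_iff, map_mul, mul_eq_zero] at hfg
    simpa only [X_sub_X_dvd_iff] using hfg

end Identify

/-- A factor of a nonzero homogeneous polynomial is a unit if its constant term is nonzero. -/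
theorem isUnit_of_mul_isHomogeneous {σ K : Type*} [Field K] {f g : MvPolynomial σ K} {n : ℕ}
    (h : (f * g).IsHomogeneous n) (hne : f * g ≠ 0) (hf : constantCoeff f ≠ 0) : IsUnit f := by
  let φ : MvPolynomial σ K →ₐ[K] Polynomial (MvPolynomial σ K) :=
    aeval fun i => Polynomial.X * Polynomial.C (X i)
  have hφ : φ (f * g) = Polynomial.C (f * g) * Polynomial.X ^ n := by
    have hmon : ∀ (d : σ →₀ ℕ) (c : K), φ (monomial d c) =
        Polynomial.C (monomial d c) * Polynomial.X ^ d.degree := by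
      intro d c
      simp only [φ, aeval_monomial, mul_pow, Finsupp.prod_mul]
      rw [monomial_eq, map_mul, Finsupp.degree_apply, ← Finset.prod_pow_eq_pow_sum, Finsupp.prod,
        Finsupp.prod, Finsupp.prod, map_prod]
      simp only [map_pow]
      rw [mul_assoc, mul_comm (∏ _ ∈ _, Polynomial.X ^ _)]
      rfl
    conv_lhs => rw [(f * g).as_sum]
    conv_rhs => rw [(f * g).as_sum]
    rw [map_sum, map_sum, Finset.sum_mul]
    refine Finset.sum_congr rfl fun d hd => ?_
    have hdn : d.degree = n := by
      rw [Finsupp.degree_eq_weight_one]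
      exact h (mem_support_iff.mp hd)
    rw [hmon, hdn]
  have h0 : ∀ p, (φ p).coeff 0 = C (constantCoeff p) := by
    intro p
    have : (Polynomial.constantCoeff.comp φ.toRingHom) =
        (C (σ := σ) (R := K)).comp constantCoeff := by
      ext i <;> simp [φ]
    exact DFunLike.congr_fun this p
  have h1 : ∀ p, (φ p).eval 1 = p := by
    intro p
    have : ((Polynomial.aeval (1 : MvPolynomial σ K)).restrictScalars K).comp φ = AlgHom.id K _ := by
      ext i; simp [φ]
    exact DFunLike.congr_fun this p
  have hfg : φ f * φ g ≠ 0 := by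
    rw [← map_mul, hφ]
    exact mul_ne_zero (Polynomial.C_ne_zero.mpr hne) (pow_ne_zero _ Polynomial.X_ne_zero)
  have hf0 := left_ne_zero_of_mul hfg
  have hg0 := right_ne_zero_of_mul hfg
  have hd : (φ f).natDegree + (φ g).natDegree = n := by
    rw [← Polynomial.natDegree_mul hf0 hg0, ← map_mul, hφ, Polynomial.natDegree_C_mul_X_pow _ _ hne]
  have ht : (φ f).natTrailingDegree + (φ g).natTrailingDegree = n := by
    rw [← Polynomial.natTrailingDegree_mul hf0 hg0, ← map_mul, hφ,
      Polynomial.natTrailingDegree_mul_X_pow (Polynomial.C_ne_zero.mpr hne),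
      Polynomial.natTrailingDegree_C, zero_add]
  have hft : (φ f).natTrailingDegree = 0 :=
    Polynomial.natTrailingDegree_eq_zero_of_constantCoeff_ne_zero (by simpa [h0] using hf)
  have := (φ g).natTrailingDegree_le_natDegree
  have hfd : (φ f).natDegree = 0 := by omega
  have hfC := Polynomial.eq_C_of_natDegree_eq_zero hfd
  have : f = C (constantCoeff f) := by
    rw [← h1 f, hfC, Polynomial.eval_C, h0]; simp
  rw [this]
  exact (isUnit_iff_ne_zero.mpr hf).map C

section Cyclic
variable {G K : Type*} [AddCommGroup G] [Field K]

/-- `F` vanishes wherever the coordinates `a` and `a + I` agree and the coordinates `l` and `l + J`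
agree. -/
def VanishesOn (F : MvPolynomial G K) (I J a l : G) : Prop :=
  ∀ r : G → G, r a = r (a + I) → r l = r (l + J) → rename r F = 0

theorem vanishesOn_iff_dvd [DecidableEq G] {F : MvPolynomial G K} {I J a l : G} :
    VanishesOn F I J a l ↔
      X (identify a (a + I) l) - X (identify a (a + I) (l + J)) ∣
        rename (identify a (a + I)) F := by
  constructor
  · intro h
    rw [X_sub_X_dvd_iff, rename_rename]
    apply h
    · simp [identify_left, identify_right]
    · simp [identify_left, identify_right]
  · intro h r ha hl
    rw [← comp_identify ha, ← rename_rename]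
    obtain ⟨Q, hQ⟩ := h
    have h1 := congrFun (comp_identify ha)
    simp only [Function.comp_apply] at h1
    rw [hQ, map_mul, map_sub, rename_X, rename_X, h1, h1, hl, sub_self, zero_mul]

variable [Fintype G]

/-- The product of all differences `X ℓ - X (ℓ + I)`. -/
noncomputable def diffProd (K : Type*) [Field K] (I : G) : MvPolynomial G K :=
  ∏ ℓ : G, (X ℓ - X (ℓ + I))

theorem isHomogeneous_diffProd (I : G) : (diffProd K I).IsHomogeneous (Fintype.card G) := by
  have := IsHomogeneous.prod (R := K) Finset.univ (fun ℓ : G => X ℓ - X (ℓ + I)) (fun _ => 1)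
    (fun i _ => (isHomogeneous_X K _).sub (isHomogeneous_X K _))
  simpa [diffProd] using this

theorem rename_diffProd (r : G → G) (I : G) :
    rename r (diffProd K I) = ∏ ℓ, (X (r ℓ) - X (r (ℓ + I))) := by
  simp [diffProd, map_prod]

theorem rename_diffProd_eq_zero {r : G → G} {I a : G} (h : r a = r (a + I)) :
    rename r (diffProd K I) = 0 := by
  rw [rename_diffProd]
  exact Finset.prod_eq_zero (Finset.mem_univ a) (by rw [h, sub_self])

variable [DecidableEq G]

theorem rename_pderiv_diffProd {r : G → G} {I a : G} (h : r a = r (a + I)) (i : G) :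
    rename r (pderiv i (diffProd K I)) =
      rename r (pderiv i (X a - X (a + I))) *
        ∏ ℓ ∈ Finset.univ.erase a, (X (r ℓ) - X (r (ℓ + I))) := by
  rw [diffProd, ← Finset.mul_prod_erase _ _ (Finset.mem_univ a), pderiv_mul, map_add, map_mul,
    map_mul, map_prod]
  simp [h]

theorem not_rename_eq_zero_and {F P : MvPolynomial G K} {A B : K} (hA : A ≠ 0) {I J : G}
    (hFP : F * P = C A * diffProd K I + C B * diffProd K J) (hI : I ≠ 0) (hIJ : I ≠ J)
    (hIJ' : I ≠ -J) {r : G → G} {a l : G} (ha : r a = r (a + I))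
    (ha' : ∀ b, r b = r (b + I) → b = a) (hl : r l = r (l + J)) :
    ¬ (rename r F = 0 ∧ rename r P = 0) := by
  rintro ⟨hF, hP⟩
  obtain ⟨i, hi, hil, hil'⟩ : ∃ i, (i = a ∨ i = a + I) ∧ i ≠ l ∧ i ≠ l + J := by
    by_contra! hcon
    have h1 := hcon a (Or.inl rfl)
    have h2 := hcon (a + I) (Or.inr rfl)
    by_cases h3 : a = l
    · subst h3
      exact hIJ (add_left_cancel (h2 (by simpa using hI)))
    · have h4 := h1 h3
      by_cases h5 : a + I = l
      · apply hIJ'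
        rw [← h5, add_assoc] at h4
        rw [eq_neg_iff_add_eq_zero]
        simpa using h4.symm
      · exact hI (by simpa [h4] using h2 h5)
  have h0 : rename r (pderiv i (F * P)) = 0 := by
    rw [pderiv_mul, map_add, map_mul, map_mul, hF, hP]; simp
  have hd : pderiv i (X l - X (l + J) : MvPolynomial G K) = 0 := by
    rw [Derivation.map_sub, pderiv_X_of_ne hil.symm, pderiv_X_of_ne hil'.symm, sub_zero]
  rw [hFP, map_add, pderiv_C_mul, pderiv_C_mul, map_add, map_mul, map_mul, rename_pderiv_diffProd ha,
    rename_pderiv_diffProd hl, hd] at h0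
  simp only [rename_C, map_zero, zero_mul, mul_zero, add_zero, mul_eq_zero,
    C_eq_zero, hA, false_or] at h0
  rcases h0 with h0 | h0
  · rcases hi with rfl | rfl <;> simp [pderiv_X, hI] at h0
  · obtain ⟨b, hb, hb'⟩ := Finset.prod_eq_zero_iff.mp h0
    exact (Finset.ne_of_mem_erase hb) (ha' b (X_injective (sub_eq_zero.mp hb')))

variable {F P : MvPolynomial G K} {A B : K} {I J : G}

theorem vanishesOn_or (hFP : F * P = C A * diffProd K I + C B * diffProd K J) (a l : G)
    (hne : identify a (a + I) l ≠ identify a (a + I) (l + J)) :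
    VanishesOn F I J a l ∨ VanishesOn P I J a l := by
  rw [vanishesOn_iff_dvd, vanishesOn_iff_dvd, ← (prime_X_sub_X hne).dvd_mul, ← map_mul, hFP,
    map_add, map_mul, map_mul, rename_diffProd_eq_zero (a := a), mul_zero, zero_add,
    rename_diffProd]
  · exact (Finset.dvd_prod_of_mem _ (Finset.mem_univ l)).mul_left _
  · rw [identify_left, identify_right]

theorem exists_vanishesOn (hB : B ≠ 0) (hFP : F * P = C A * diffProd K I + C B * diffProd K J)
    (hJ : J ≠ 0) (hIJ : I ≠ J) (hIJ' : I ≠ -J) (hF : constantCoeff F = 0) (a : G) :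
    ∃ l, VanishesOn F I J a l := by
  have hq : rename (identify a (a + I)) F * rename (identify a (a + I)) P =
      C B * ∏ ℓ, (X (identify a (a + I) ℓ) - X (identify a (a + I) (ℓ + J))) := by
    rw [← map_mul, hFP, map_add, map_mul, map_mul, rename_diffProd_eq_zero (a := a), mul_zero,
      zero_add, rename_diffProd, rename_C]
    rw [identify_left, identify_right]
  have hne : rename (identify a (a + I)) F ≠ 0 := by
    have h : rename (identify a (a + I)) F * rename (identify a (a + I)) P ≠ 0 := by
      rw [hq]
      exact mul_ne_zero (C_ne_zero.mpr hB) (Finset.prod_ne_zero_iff.mpr fun l _ =>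
        X_sub_X_ne_zero (identify_ne hJ hIJ hIJ' a l))
    exact left_ne_zero_of_mul h
  have hu : ¬ IsUnit (rename (identify a (a + I)) F) := by
    intro hu
    have := hu.map (constantCoeff (R := K) (σ := G))
    simp [constantCoeff_rename, hF] at this
  obtain ⟨p, hp, hpF⟩ := WfDvdMonoid.exists_irreducible_factor hu hne
  have hpd := (hpF.mul_right _).trans hq.dvd
  rcases hp.prime.dvd_or_dvd hpd with h | h
  · exact absurd (isUnit_of_dvd_unit h ((isUnit_iff_ne_zero.mpr hB).map C)) hp.not_isUnit
  · obtain ⟨l, -, hl⟩ := hp.prime.exists_mem_finset_dvd h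
    refine ⟨l, vanishesOn_iff_dvd.mpr ?_⟩
    exact ((hp.associated_of_dvd (prime_X_sub_X (identify_ne hJ hIJ hIJ' a l)).irreducible
      hl).dvd'.trans hpF)

end Cyclic

/-- If `p` says which points a map identifies, then `Glue i j p` does so for the composite of that
map with the identification of the images of `i` and `j`. -/
def Glue {σ : Type*} (i j : σ) (p : σ → σ → Prop) (x y : σ) : Prop :=
  p x y ∨ (p x i ∧ p y j) ∨ (p x j ∧ p y i)

/-- After identifying `a` with `a + I`, `l` with `l + J` and `m` with `m + J`, the only point
that is identified with its translate by `I` is `a`. -/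
def OnlyEdge {G : Type*} [AddCommGroup G] (I J a l m : G) : Prop :=
  ∀ b, Glue m (m + J) (Glue l (l + J) (Glue a (a + I) (· = ·))) b (b + I) → b = a

set_option maxHeartbeats 4000000 in
theorem onlyEdge_of_generic {R : Type*} [CommRing R] [DecidableEq R] {I J a h m : R} (hI : I ≠ 0)
    (hJ : J ≠ 0) (h1 : I ≠ J) (h2 : I ≠ -J) (h3 : 2 * I ≠ 0) (h4 : 2 * I ≠ 2 * J) (h5 : J ≠ 2 * I)
    (h6 : J ≠ -(2 * I)) (h7 : I ≠ 2 * J) (h8 : I ≠ -(2 * J))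
    (hh1 : h ≠ a) (hh2 : h ≠ a + I) (hh3 : h ≠ a - J) (hh4 : h ≠ a + I - J)
    (hh5 : 2 * I + 2 * J = 0 → h ≠ a + 2 * I ∧ h ≠ a + I + J) :
    OnlyEdge I J a h m := by
  intro b
  simp only [Glue]
  grind (splits := 60)

set_option maxHeartbeats 4000000 in
theorem onlyEdge_of_eq_two_mul_aux {R : Type*} [CommRing R] (b m J I a h z : R) (_hz : z = 3 * b)
    (w : R) (hw : w = b + m) (h1 : J ≠ 0) (h2 : 2 * J ≠ 0) (h3 : 3 * J ≠ 0)
    (h4 : 4 * J ≠ 0) (h5 : 5 * J ≠ 0)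
    (hI : (I = 2 * J ∧ a = 0) ∨ (I = -(2 * J) ∧ a = 2 * J))
    (hm : (h = 4 * J ∧ m ≠ 3 * J ∧ m ≠ 5 * J) ∨ (h = 3 * J ∧ m = 0) ∨ (h = 5 * J ∧ m = 3 * J)) :
    Glue m (m + J) (Glue h (h + J) (Glue a (a + I) (· = ·))) b (b + I) → b = a := by
  simp only [Glue]
  rcases hI with ⟨rfl, rfl⟩ | ⟨rfl, rfl⟩ <;>
    rcases hm with ⟨rfl, hm, hm'⟩ | ⟨rfl, rfl⟩ | ⟨rfl, rfl⟩ <;>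
    grind (splits := 60)

theorem onlyEdge_of_eq_two_mul {R : Type*} [CommRing R] {m J I a h : R}
    (hJ : ∀ k : ℕ, 1 ≤ k → k ≤ 5 → (k : R) * J ≠ 0)
    (hI : (I = 2 * J ∧ a = 0) ∨ (I = -(2 * J) ∧ a = 2 * J))
    (hm : (h = 4 * J ∧ m ≠ 3 * J ∧ m ≠ 5 * J) ∨ (h = 3 * J ∧ m = 0) ∨ (h = 5 * J ∧ m = 3 * J)) :
    OnlyEdge I J a h m := fun b =>
  onlyEdge_of_eq_two_mul_aux b m J I a h _ rfl _ rfl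
    (by simpa using hJ 1 (by norm_num) (by norm_num))
    (by simpa using hJ 2 (by norm_num) (by norm_num))
    (by simpa using hJ 3 (by norm_num) (by norm_num))
    (by simpa using hJ 4 (by norm_num) (by norm_num))
    (by simpa using hJ 5 (by norm_num) (by norm_num)) hI hm
/-- The vector `v` as a function on `ZMod 5`, translated by `o`. -/
def pattern (v : Fin 5 → ZMod 5) (o x : ZMod 5) : ZMod 5 := v (show ZMod 5 from x - o)

set_option synthInstance.maxHeartbeats 2000000 in
set_option synthInstance.maxSize 4000 in
set_option maxHeartbeats 4000000 in
set_option maxRecDepth 100000 in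
/-- The combinatorial input for `n = 5`: a coloring `r` moves a vanishing condition from `a` to
another point, and a coloring `s` then has a single monochromatic edge of step `1` and four of step `J`. -/
theorem exists_coloring_zmod_five : ∀ J ∈ ({2, 3} : Finset (ZMod 5)), ∀ a l : ZMod 5,
    ∃ a' l1 l2 l3 : ZMod 5, ∃ r s : ZMod 5 → ZMod 5,
    (a' = a ∨ (r a = r (a + 1) ∧ r a' = r (a' + 1) ∧ r l = r (l + J) ∧
      ∀ k, r k = r (k + J) → k = l)) ∧
    s l = s (l + J) ∧ s l1 = s (l1 + J) ∧ s l2 = s (l2 + J) ∧ s l3 = s (l3 + J) ∧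
    s a' = s (a' + 1) ∧
    l1 ≠ l2 ∧ l1 ≠ l3 ∧ l2 ≠ l3 ∧ ∀ k, s k = s (k + 1) → k = a' := by
  intro J hJ
  simp only [Finset.mem_insert, Finset.mem_singleton] at hJ
  rcases hJ with rfl | rfl
  · intro a l
    refine ⟨if a - l ∈ ({0, 1, 3} : Finset (ZMod 5)) then l + 3 else a, ?_⟩
    generalize h : (if a - l ∈ ({0, 1, 3} : Finset (ZMod 5)) then l + 3 else a) = a'
    refine ⟨a' - 2, a' + 1, a' + 2, pattern ![0, 0, 0, 1, 1] l,
      pattern ![0, 1, 0, 0, 1] (a' - 2), ?_⟩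
    decide +revert
  · intro a l
    refine ⟨if a - (l + 3) ∈ ({0, 1, 3} : Finset (ZMod 5)) then l + 1 else a, ?_⟩
    generalize h : (if a - (l + 3) ∈ ({0, 1, 3} : Finset (ZMod 5)) then l + 1 else a) = a'
    refine ⟨a', a' + 3, a' + 4, pattern ![0, 0, 0, 1, 1] (l + 3),
      pattern ![0, 1, 0, 0, 1] (a' - 2), ?_⟩
    decide +revert

/-- `F * P` is a combination of `diffProd K I` and `diffProd K J` with nonzero coefficients, both
factors have zero constant term, and the shifts `I` and `J` are in general position. -/
structure IsSplitting {G K : Type*} [AddCommGroup G] [Fintype G] [Field K]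
    (F P : MvPolynomial G K) (A B : K) (I J : G) : Prop where
  mul_eq : F * P = C A * diffProd K I + C B * diffProd K J
  left_ne : A ≠ 0
  right_ne : B ≠ 0
  constantCoeff_left : constantCoeff F = 0
  constantCoeff_right : constantCoeff P = 0
  shift_left : I ≠ 0
  shift_right : J ≠ 0
  shift_ne : I ≠ J
  shift_ne_neg : I ≠ -J

namespace IsSplitting

section
variable {G K : Type*} [AddCommGroup G] [Fintype G] [Field K]
  {F P : MvPolynomial G K} {A B : K} {I J : G}

theorem swap_factors (S : IsSplitting F P A B I J) : IsSplitting P F A B I J :=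
  { S with
    mul_eq := by rw [mul_comm, S.mul_eq]
    constantCoeff_left := S.constantCoeff_right
    constantCoeff_right := S.constantCoeff_left }

theorem swap_shifts (S : IsSplitting F P A B I J) : IsSplitting F P B A J I where
  mul_eq := by rw [add_comm, S.mul_eq]
  left_ne := S.right_ne
  right_ne := S.left_ne
  constantCoeff_left := S.constantCoeff_left
  constantCoeff_right := S.constantCoeff_right
  shift_left := S.shift_right
  shift_right := S.shift_left
  shift_ne := S.shift_ne.symm
  shift_ne_neg := fun h => S.shift_ne_neg (by rw [h, neg_neg])

theorem totalDegree_add (S : IsSplitting F P A B I J) (hne : F * P ≠ 0) :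
    F.totalDegree + P.totalDegree = Fintype.card G := by
  rw [← totalDegree_mul_of_isDomain (left_ne_zero_of_mul hne) (right_ne_zero_of_mul hne)]
  refine IsHomogeneous.totalDegree ?_ hne
  rw [S.mul_eq]
  exact ((isHomogeneous_diffProd I).C_mul A).add ((isHomogeneous_diffProd J).C_mul B)

variable [DecidableEq G]

theorem vanishes_or (S : IsSplitting F P A B I J) (a l : G) :
    VanishesOn F I J a l ∨ VanishesOn P I J a l :=
  vanishesOn_or S.mul_eq a l (identify_ne S.shift_right S.shift_ne S.shift_ne_neg a l)

theorem exists_vanishes (S : IsSplitting F P A B I J) (a : G) : ∃ l, VanishesOn F I J a l :=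
  exists_vanishesOn S.right_ne S.mul_eq S.shift_right S.shift_ne S.shift_ne_neg
    S.constantCoeff_left a

theorem not_rename (S : IsSplitting F P A B I J) {r : G → G} {a l : G} (ha : r a = r (a + I))
    (ha' : ∀ b, r b = r (b + I) → b = a) (hl : r l = r (l + J)) :
    ¬ (rename r F = 0 ∧ rename r P = 0) :=
  not_rename_eq_zero_and S.left_ne S.mul_eq S.shift_left S.shift_ne S.shift_ne_neg ha ha' hl

theorem not_vanishesOn (S : IsSplitting F P A B I J) {a l m : G} (h : OnlyEdge I J a l m)
    (hF : VanishesOn F I J a l) : ¬ VanishesOn P I J a m := by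
  intro hP
  set r₁ := identify a (a + I) with hr₁
  set r₂ := identify (r₁ l) (r₁ (l + J)) ∘ r₁ with hr₂
  set r₃ := identify (r₂ m) (r₂ (m + J)) ∘ r₂ with hr₃
  have e₁ : r₁ a = r₁ (a + I) := by rw [hr₁, identify_left, identify_right]
  have e₂ : r₂ l = r₂ (l + J) := by
    rw [hr₂, Function.comp_apply, Function.comp_apply, identify_left, identify_right]
  have e₃ : r₃ m = r₃ (m + J) := by
    rw [hr₃, Function.comp_apply, Function.comp_apply, identify_left, identify_right]
  have e₂' : r₂ a = r₂ (a + I) := by rw [hr₂, Function.comp_apply, e₁, Function.comp_apply]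
  have e₃' : r₃ a = r₃ (a + I) := by rw [hr₃, Function.comp_apply, e₂', Function.comp_apply]
  have e₃'' : r₃ l = r₃ (l + J) := by rw [hr₃, Function.comp_apply, e₂, Function.comp_apply]
  refine S.not_rename e₃' (fun b hb => h b ?_) e₃'' ⟨hF _ e₃' e₃'', hP _ e₃' e₃⟩
  simpa only [hr₃, hr₂, identify_comp_eq_iff, hr₁, identify_eq_iff, Glue] using hb

theorem false_of_forall_onlyEdge (S : IsSplitting F P A B I J) {a h : G}
    (hgood : ∀ m, OnlyEdge I J a h m) : False := by
  rcases S.vanishes_or a h with hF | hP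
  · obtain ⟨m, hm⟩ := S.swap_factors.exists_vanishes a
    exact S.not_vanishesOn (hgood m) hF hm
  · obtain ⟨m, hm⟩ := S.exists_vanishes a
    exact S.swap_factors.not_vanishesOn (hgood m) hP hm

end

variable {R K : Type*} [CommRing R] [Fintype R] [DecidableEq R] [Field K]
  {F P : MvPolynomial R K} {A B : K} {I J : R}

theorem false_of_generic (S : IsSplitting F P A B I J) (h3 : 2 * I ≠ 0) (h4 : 2 * I ≠ 2 * J)
    (h5 : J ≠ 2 * I) (h6 : J ≠ -(2 * I)) (h7 : I ≠ 2 * J) (h8 : I ≠ -(2 * J))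
    (hcard : 4 < Fintype.card R) (hcard' : 2 * I + 2 * J = 0 → 6 < Fintype.card R) : False := by
  have key : ∃ h : R, h ≠ 0 ∧ h ≠ 0 + I ∧ h ≠ 0 - J ∧ h ≠ 0 + I - J ∧
      (2 * I + 2 * J = 0 → h ≠ 0 + 2 * I ∧ h ≠ 0 + I + J) := by
    by_cases h0 : 2 * I + 2 * J = 0
    · obtain ⟨h, -, hh⟩ := Finset.exists_mem_notMem_of_card_lt_card
        (s := ({0, 0 + I, 0 - J, 0 + I - J, 0 + 2 * I, 0 + I + J} : Finset R)) (t := Finset.univ)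
        (Finset.card_le_six.trans_lt (hcard' h0))
      refine ⟨h, ?_⟩
      simpa [not_or, and_assoc, h0] using hh
    · obtain ⟨h, -, hh⟩ := Finset.exists_mem_notMem_of_card_lt_card
        (s := ({0, 0 + I, 0 - J, 0 + I - J} : Finset R)) (t := Finset.univ)
        (Finset.card_le_four.trans_lt hcard)
      refine ⟨h, ?_⟩
      simpa [not_or, and_assoc, h0] using hh
  obtain ⟨h, hh1, hh2, hh3, hh4, hh5⟩ := key
  exact S.false_of_forall_onlyEdge fun m => onlyEdge_of_generic S.shift_left S.shift_right
    S.shift_ne S.shift_ne_neg h3 h4 h5 h6 h7 h8 hh1 hh2 hh3 hh4 hh5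

theorem not_vanishesOn_four_mul (S : IsSplitting F P A B I J) {a : R}
    (hJ : ∀ k : ℕ, 1 ≤ k → k ≤ 5 → (k : R) * J ≠ 0)
    (hI : (I = 2 * J ∧ a = 0) ∨ (I = -(2 * J) ∧ a = 2 * J)) :
    ¬ VanishesOn F I J a (4 * J) := by
  intro h4
  have n3 : (0 : R) ≠ 3 * J := by simpa using (hJ 3 (by norm_num) (by norm_num)).symm
  have n5 : (0 : R) ≠ 5 * J := by simpa using (hJ 5 (by norm_num) (by norm_num)).symm
  have g4 : ∀ m, m ≠ 3 * J → m ≠ 5 * J → ¬ VanishesOn P I J a m := fun m hm hm' =>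
    S.not_vanishesOn (onlyEdge_of_eq_two_mul hJ hI (.inl ⟨rfl, hm, hm'⟩)) h4
  have g3 : ¬ VanishesOn P I J a (3 * J) := fun h3 => by
    have h0 := S.swap_factors.not_vanishesOn
      (onlyEdge_of_eq_two_mul hJ hI (.inr (.inl ⟨rfl, rfl⟩))) h3
    exact g4 0 n3 n5 ((S.vanishes_or a 0).resolve_left h0)
  obtain ⟨m, hm⟩ := S.swap_factors.exists_vanishes a
  have hm3 : m ≠ 3 * J := fun h => g3 (h ▸ hm)
  have hm5 : m = 5 * J := by
    by_contra hm5
    exact g4 m hm3 hm5 hm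
  subst hm5
  have h3 := S.swap_factors.not_vanishesOn
    (onlyEdge_of_eq_two_mul hJ hI (.inr (.inr ⟨rfl, rfl⟩))) hm
  exact g3 ((S.vanishes_or a (3 * J)).resolve_left h3)

theorem false_of_eq_two_mul (S : IsSplitting F P A B I J)
    (hJ : ∀ k : ℕ, 1 ≤ k → k ≤ 5 → (k : R) * J ≠ 0) (hI : I = 2 * J ∨ I = -(2 * J)) : False := by
  obtain ⟨a, ha⟩ : ∃ a, (I = 2 * J ∧ a = 0) ∨ (I = -(2 * J) ∧ a = 2 * J) := by
    rcases hI with h | h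
    · exact ⟨0, .inl ⟨h, rfl⟩⟩
    · exact ⟨2 * J, .inr ⟨h, rfl⟩⟩
  exact (S.vanishes_or a (4 * J)).elim (S.not_vanishesOn_four_mul hJ ha)
    (S.swap_factors.not_vanishesOn_four_mul hJ ha)

theorem false_of_five {F P : MvPolynomial (ZMod 5) K} {J : ZMod 5}
    (S : IsSplitting F P A B 1 J) (hJ : J ∈ ({2, 3} : Finset (ZMod 5)))
    (hdeg : F.totalDegree ≤ 2) : False := by
  obtain ⟨l, hl⟩ := S.exists_vanishes 0
  obtain ⟨a, l₁, l₂, l₃, r, s, hr, hs, hs₁, hs₂, hs₃, hsa, h12, h13, h23, hs'⟩ :=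
    exists_coloring_zmod_five J hJ 0 l
  have hal : VanishesOn F 1 J a l := by
    rcases hr with rfl | ⟨hr0, hra, hrl, hr'⟩
    · exact hl
    · refine (S.vanishes_or a l).resolve_right fun hP => ?_
      exact S.swap_shifts.not_rename hrl hr' hra ⟨hl r hr0 hrl, hP r hra hrl⟩
  have hsP : rename s P ≠ 0 := fun h => S.not_rename hsa hs' hs ⟨hal s hsa hs, h⟩
  set q := identify a (a + 1) with hq
  have hrel : ∀ m, s m = s (m + J) →
      IsRelPrime (X (q m) - X (q (m + J)) : MvPolynomial (ZMod 5) K) (rename q P) := by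
    intro m hm
    have hp := prime_X_sub_X (K := K) (identify_ne S.shift_right S.shift_ne S.shift_ne_neg a m)
    refine (hp.irreducible.isRelPrime_iff_not_dvd).mpr fun hd => ?_
    exact hsP (vanishesOn_iff_dvd.mpr hd s hsa hm)
  have hqm : rename q F * rename q P = C B * ∏ m, (X (q m) - X (q (m + J))) := by
    rw [← map_mul, S.mul_eq, map_add, map_mul, map_mul, rename_diffProd_eq_zero (a := a), mul_zero,
      zero_add, rename_diffProd, rename_C]
    rw [hq, identify_left, identify_right]
  have hq0 : rename q F * rename q P ≠ 0 := by
    rw [hqm]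
    exact mul_ne_zero (C_ne_zero.mpr S.right_ne) (Finset.prod_ne_zero_iff.mpr fun m _ =>
      X_sub_X_ne_zero (identify_ne S.shift_right S.shift_ne S.shift_ne_neg a m))
  set T : Finset (ZMod 5) := {l₁, l₂, l₃} with hT
  have hTc : T.card = 3 := by
    rw [hT, Finset.card_eq_three]
    exact ⟨l₁, l₂, l₃, h12, h13, h23, rfl⟩
  have hTd : ∏ m ∈ T, (X (q m) - X (q (m + J))) ∣ rename q F := by
    refine IsRelPrime.dvd_of_dvd_mul_right (z := rename q P) ?_ ?_
    · refine IsRelPrime.prod_left fun m hm => hrel m ?_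
      simp only [hT, Finset.mem_insert, Finset.mem_singleton] at hm
      rcases hm with rfl | rfl | rfl <;> assumption
    · rw [hqm]
      exact (Finset.prod_dvd_prod_of_subset _ _ _ (Finset.subset_univ T)).mul_left _
  have hTh : (∏ m ∈ T, (X (q m) - X (q (m + J))) : MvPolynomial (ZMod 5) K).IsHomogeneous 3 := by
    have := IsHomogeneous.prod (R := K) T (fun m => X (q m) - X (q (m + J))) (fun _ => 1)
      (fun i _ => (isHomogeneous_X K _).sub (isHomogeneous_X K _))
    simpa [hTc] using this
  obtain ⟨Q, hQ⟩ := hTd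
  have hF0 : (∏ m ∈ T, (X (q m) - X (q (m + J)))) * Q ≠ 0 := hQ ▸ left_ne_zero_of_mul hq0
  have h3 := totalDegree_mul_of_isDomain (left_ne_zero_of_mul hF0) (right_ne_zero_of_mul hF0)
  rw [hTh.totalDegree (left_ne_zero_of_mul hF0), ← hQ] at h3
  have := totalDegree_rename_le q F
  omega

end IsSplitting

theorem diffProd_combination_ne_zero {G K : Type*} [AddCommGroup G] [Fintype G] [DecidableEq G]
    [Field K] {A B : K} {I J : G} (hB : B ≠ 0) (hJ : J ≠ 0) (hIJ : I ≠ J) (hIJ' : I ≠ -J) :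
    C A * diffProd K I + C B * diffProd K J ≠ 0 := by
  intro h0
  have h := congrArg (rename (identify (0 : G) (0 + I))) h0
  rw [map_add, map_mul, map_mul, rename_diffProd_eq_zero (a := 0), mul_zero, zero_add,
    rename_diffProd, rename_C, map_zero] at h
  · exact mul_ne_zero (C_ne_zero.mpr hB) (Finset.prod_ne_zero_iff.mpr fun l _ =>
      X_sub_X_ne_zero (identify_ne hJ hIJ hIJ' 0 l)) h
  · rw [identify_left, identify_right]

theorem natCast_mul_ne_zero_of_isUnit {n : ℕ} {J : ZMod n} (hJ : IsUnit J) {k : ℕ} (hk : 1 ≤ k)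
    (hkn : k < n) : (k : ZMod n) * J ≠ 0 := by
  rw [Ne, hJ.mul_left_eq_zero, ZMod.natCast_eq_zero_iff]
  exact fun h => absurd (Nat.le_of_dvd hk h) (by omega)

theorem IsSplitting.false_of_isUnit_sub {K : Type*} [Field K] {n : ℕ} [NeZero n] {I J : ZMod n}
    {F P : MvPolynomial (ZMod n) K} {A B : K} (S : IsSplitting F P A B I J) (hn : 5 < n)
    (hu : IsUnit (J - I)) (h3 : 2 * I ≠ 0)
    (hcard' : 2 * I + 2 * J = 0 → J ≠ 2 * I → 6 < n) : False := by
  have hunit : ∀ {x y : ZMod n}, IsUnit (y - x) → x = 2 * y ∨ x = -(2 * y) → IsUnit y := by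
    rintro x y hu (rfl | rfl)
    · have : y - 2 * y = -y := by ring
      rwa [this, IsUnit.neg_iff] at hu
    · have : y - -(2 * y) = 3 * y := by ring
      rw [this] at hu
      exact isUnit_of_mul_isUnit_right hu
  by_cases h7 : I = 2 * J ∨ I = -(2 * J)
  · exact S.false_of_eq_two_mul (fun k hk hk' =>
      natCast_mul_ne_zero_of_isUnit (hunit hu h7) hk (hk'.trans_lt hn)) h7
  by_cases h5 : J = 2 * I ∨ J = -(2 * I)
  · have hu' : IsUnit (I - J) := by rwa [← neg_sub, IsUnit.neg_iff]
    exact S.swap_shifts.false_of_eq_two_mul (fun k hk hk' =>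
      natCast_mul_ne_zero_of_isUnit (hunit hu' h5) hk (hk'.trans_lt hn)) h5
  push Not at h5 h7
  refine S.false_of_generic h3 ?_ h5.1 h5.2 h7.1 h7.2 (by rw [ZMod.card]; omega)
    (fun h => by rw [ZMod.card]; exact hcard' h h5.1)
  intro h
  have h0 : ((2 : ℕ) : ZMod n) * (J - I) = 0 := by
    push_cast
    rw [mul_sub, h, sub_self]
  exact natCast_mul_ne_zero_of_isUnit hu one_le_two (by omega) h0

/-- Let `K` be algebraically closed, `n ≥ 5`, `1 ≤ I < J ≤ n - 1` with `I + J < n` and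
`gcd (J - I) n = 1`, and `A ∈ K \ {0}`. Then
`P = A ∏_ℓ (X_ℓ - X_{ℓ+I}) - ∏_ℓ (X_ℓ - X_{ℓ+J})` (variables indexed by `ZMod n`, indices
taken modulo `n`) is irreducible in `K[X_0, …, X_{n-1}]`. -/
theorem stmt_8 (K : Type*) [Field K] [IsAlgClosed K] (n : ℕ) [NeZero n] (hn : 5 ≤ n)
    (I J : ℕ) (hI : 1 ≤ I) (hIJ : I < J) (hJ : J ≤ n - 1) (hsum : I + J < n)
    (hgcd : Nat.gcd (J - I) n = 1) (A : K) (hA : A ≠ 0) :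
    Irreducible
      (C A * ∏ ℓ : ZMod n, (X ℓ - X (ℓ + (I : ZMod n)))
        - ∏ ℓ : ZMod n, (X ℓ - X (ℓ + (J : ZMod n))) : MvPolynomial (ZMod n) K) := by
  have hne : ∀ k, 1 ≤ k → k < n → (k : ZMod n) ≠ 0 := fun k hk hkn h =>
    absurd (Nat.le_of_dvd hk ((ZMod.natCast_eq_zero_iff k n).mp h)) (by omega)
  have hI0 : (I : ZMod n) ≠ 0 := hne I hI (by omega)
  have hJ0 : (J : ZMod n) ≠ 0 := hne J (by omega) (by omega)
  have hsub : ((J - I : ℕ) : ZMod n) = (J : ZMod n) - I := Nat.cast_sub hIJ.le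
  have hIJ0 : (I : ZMod n) ≠ J := fun h =>
    hne (J - I) (by omega) (by omega) (by rw [hsub, h, sub_self])
  have hIJ1 : (I : ZMod n) ≠ -J := fun h =>
    hne (I + J) (by omega) hsum (by push_cast; rw [h, neg_add_cancel])
  have hu : IsUnit ((J : ZMod n) - I) := by
    rw [← hsub]
    exact (ZMod.isUnit_iff_coprime _ _).mpr hgcd
  have hform : (C A * ∏ ℓ : ZMod n, (X ℓ - X (ℓ + (I : ZMod n)))
      - ∏ ℓ : ZMod n, (X ℓ - X (ℓ + (J : ZMod n))) : MvPolynomial (ZMod n) K) =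
      C A * diffProd K (I : ZMod n) + C (-1) * diffProd K (J : ZMod n) := by
    rw [diffProd, diffProd, map_neg, map_one, neg_one_mul, sub_eq_add_neg]
  rw [hform]
  have hP0 := diffProd_combination_ne_zero (A := A) (neg_ne_zero.mpr (one_ne_zero (α := K)))
    hJ0 hIJ0 hIJ1
  have hhom : (C A * diffProd K (I : ZMod n) + C (-1) * diffProd K (J : ZMod n)).IsHomogeneous
      (Fintype.card (ZMod n)) :=
    ((isHomogeneous_diffProd _).C_mul A).add ((isHomogeneous_diffProd _).C_mul _)
  refine ⟨fun h => ?_, fun F G hFG => ?_⟩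
  · have := h.map (constantCoeff (R := K) (σ := ZMod n))
    simp [diffProd, Finset.prod_const, NeZero.ne n] at this
  by_contra! hcon
  have hF : constantCoeff F = 0 := by
    by_contra hc
    exact hcon.1 (isUnit_of_mul_isHomogeneous (hFG ▸ hhom) (hFG ▸ hP0) hc)
  have hG : constantCoeff G = 0 := by
    by_contra hc
    have hGF := hFG.trans (mul_comm F G)
    exact hcon.2 (isUnit_of_mul_isHomogeneous (hGF ▸ hhom) (hGF ▸ hP0) hc)
  have S : IsSplitting F G A (-1) (I : ZMod n) (J : ZMod n) :=
    ⟨hFG.symm, hA, neg_ne_zero.mpr one_ne_zero, hF, hG, hI0, hJ0, hIJ0, hIJ1⟩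
  rcases hn.eq_or_lt with rfl | hn
  · have hdeg := S.totalDegree_add (hFG ▸ hP0)
    rw [ZMod.card] at hdeg
    obtain rfl : I = 1 := by omega
    have hJm : ((J : ℕ) : ZMod 5) ∈ ({2, 3} : Finset (ZMod 5)) := by
      obtain rfl | rfl : J = 2 ∨ J = 3 := by omega
      · decide
      · decide
    rw [Nat.cast_one] at S
    rcases le_or_gt F.totalDegree 2 with h | h
    · exact S.false_of_five hJm h
    · exact S.swap_factors.false_of_five hJm (by omega)
  · refine S.false_of_isUnit_sub hn hu ?_ ?_
    · have := hne (2 * I) (by omega) (by omega)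
      rwa [Nat.cast_mul, Nat.cast_ofNat] at this
    · intro h h5
      by_contra hn6
      obtain rfl : n = 6 := by omega
      have hd : 6 ∣ 2 * I + 2 * J := by
        rw [← ZMod.natCast_eq_zero_iff]
        push_cast
        exact h
      obtain ⟨rfl, rfl⟩ : I = 1 ∧ J = 2 := by omega
      exact h5 (by norm_num)
end

section
/- Let K be an algebraically closed field (of any characteristic), m ≥ 2, and let a, b, c ∈ K[X_2, …, X_m] with a ≠ 0 and b ≠ 0, such that a, b, c have no non-constant common factor. For a nonzero polynomial f ∈ K[X_2, …, X_m] and a point Q = (u_2, …, u_m) ∈ K^{m−1}, let m_Q(f) denote the multiplicity of f at Q, i.e., the least total degree of a nonzero homogeneous component of f(X_2 + u_2, …, X_m + u_m). If there exists Q ∈ K^{m−1} such that m_Q(a·c) is odd and 2·m_Q(b) > m_Q(a·c), then the polynomial p := a·X_1^2 + b·X_1 + c is irreducible in K[X_1, X_2, …, X_m]. -/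
open MvPolynomial

/-- The multiplicity of a multivariate polynomial `f` at a point `Q`: the least total degree
of a nonzero homogeneous component of the translated polynomial `f (X + Q)`. -/
noncomputable def multAt {σ K : Type*} [CommSemiring K] (Q : σ → K)
    (f : MvPolynomial σ K) : ℕ :=
  sInf {k | homogeneousComponent k (bind₁ (fun i => X i + C (Q i)) f) ≠ 0}

namespace multAt

variable {σ K : Type*} [Field K] (Q : σ → K)

theorem translate_injective :
    Function.Injective (bind₁ (fun i => X i + C (Q i)) :
      MvPolynomial σ K →ₐ[K] MvPolynomial σ K) := by
  refine Function.LeftInverse.injective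
    (g := (bind₁ (fun i => X i - C (Q i)) : MvPolynomial σ K →ₐ[K] MvPolynomial σ K)) fun f => ?_
  rw [← AlgHom.comp_apply]
  conv_rhs => rw [← AlgHom.id_apply (R := K) f]
  congr 1
  ext i
  simp

theorem zero : multAt Q (0 : MvPolynomial σ K) = 0 := by
  simp [multAt]

theorem coe_eq_order {f : MvPolynomial σ K} (hf : f ≠ 0) :
    (multAt Q f : ℕ∞) =
      MvPowerSeries.order (bind₁ (fun i => X i + C (Q i)) f : MvPowerSeries σ K) := by
  have hg : bind₁ (fun i => X i + C (Q i)) f ≠ 0 :=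
    (map_ne_zero_iff _ (translate_injective Q)).2 hf
  rw [multAt]
  generalize bind₁ (fun i => X i + C (Q i)) f = g at hg
  have hne : {k | homogeneousComponent k g ≠ 0}.Nonempty := by
    by_contra! h
    refine hg ((sum_homogeneousComponent g).symm.trans (Finset.sum_eq_zero fun i _ => ?_))
    simpa using Set.eq_empty_iff_forall_notMem.1 h i
  symm
  rw [MvPowerSeries.order_eq_nat]
  refine ⟨?_, fun d hd => ?_⟩
  · obtain ⟨d, hd⟩ := ne_zero_iff.1 (Nat.sInf_mem hne)
    rw [coeff_homogeneousComponent] at hd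
    split_ifs at hd with h
    · exact ⟨d, by simpa using hd, h⟩
    · exact absurd rfl hd
  · have h := Nat.notMem_of_lt_sInf hd
    rw [Set.mem_ofPred_eq, not_not] at h
    simpa [coeff_homogeneousComponent] using congrArg (coeff d) h

theorem mul {f g : MvPolynomial σ K} (hf : f ≠ 0) (hg : g ≠ 0) :
    multAt Q (f * g) = multAt Q f + multAt Q g := by
  have h := coe_eq_order Q (mul_ne_zero hf hg)
  rw [map_mul, coe_mul, MvPowerSeries.order_mul, ← coe_eq_order Q hf, ← coe_eq_order Q hg] at h
  exact_mod_cast h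

theorem add_of_ne {f g : MvPolynomial σ K} (hf : f ≠ 0) (hg : g ≠ 0)
    (h : multAt Q f ≠ multAt Q g) :
    multAt Q (f + g) = min (multAt Q f) (multAt Q g) := by
  have hfg : f + g ≠ 0 := by
    intro h0
    rw [eq_neg_of_add_eq_zero_left h0] at h
    simp [multAt] at h
  have key := coe_eq_order Q hfg
  rw [map_add, coe_add, MvPowerSeries.order_add_of_order_ne, ← coe_eq_order Q hf,
    ← coe_eq_order Q hg] at key
  · exact Nat.cast_injective (key.trans (Nat.mono_cast.map_min).symm)
  · rw [← coe_eq_order Q hf, ← coe_eq_order Q hg]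
    exact_mod_cast h

theorem two_mul_add_lt_of_odd_mul {f g : MvPolynomial σ K} (h : Odd (multAt Q (f * g))) :
    2 * multAt Q (f + g) < multAt Q (f * g) := by
  have hfg : f * g ≠ 0 := by
    intro h0
    simp [h0, zero] at h
  have hf := left_ne_zero_of_mul hfg
  have hg := right_ne_zero_of_mul hfg
  rw [mul Q hf hg] at h ⊢
  have hne : multAt Q f ≠ multAt Q g := by
    intro h0
    rw [h0] at h
    exact Nat.not_odd_iff_even.2 ⟨_, rfl⟩ h
  rw [add_of_ne Q hf hg hne]
  omega

end multAt

namespace Polynomial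

/-- A quadratic polynomial over a domain with coprime coefficients is irreducible as soon as it is
not a product of two polynomials of degree one. -/
theorem irreducible_quadratic_of_forall_ne {R : Type*} [CommRing R] [IsDomain R] {a b c : R}
    (ha : a ≠ 0) (hunit : ∀ d, d ∣ a → d ∣ b → d ∣ c → IsUnit d)
    (hfac : ∀ p q r s, a = p * r → c = q * s → b ≠ p * s + q * r) :
    Irreducible (C a * X ^ 2 + C b * X + C c) := by
  have hdeg := natDegree_quadratic (b := b) (c := c) ha
  have unit_of_dvd : ∀ f, f.natDegree = 0 → f ∣ C a * X ^ 2 + C b * X + C c → IsUnit f := by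
    intro f hf hdvd
    rw [eq_C_of_natDegree_eq_zero hf, C_dvd_iff_dvd_coeff] at hdvd
    rw [eq_C_of_natDegree_eq_zero hf]
    refine isUnit_C.2 (hunit _ ?_ ?_ ?_)
    · simpa [coeff_X, coeff_C] using hdvd 2
    · simpa [coeff_X, coeff_C] using hdvd 1
    · simpa [coeff_X, coeff_C] using hdvd 0
  refine ⟨fun h => ?_, fun f g hfg => ?_⟩
  · rw [natDegree_eq_zero_of_isUnit h] at hdeg
    omega
  · have hne : f * g ≠ 0 := by
      rw [← hfg]
      rintro h0
      simp [h0] at hdeg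
    have hsum : f.natDegree + g.natDegree = 2 := by
      rw [← natDegree_mul (left_ne_zero_of_mul hne) (right_ne_zero_of_mul hne), ← hfg, hdeg]
    by_cases hf : f.natDegree = 0
    · exact Or.inl (unit_of_dvd f hf (hfg ▸ dvd_mul_right f g))
    by_cases hg : g.natDegree = 0
    · exact Or.inr (unit_of_dvd g hg (hfg ▸ dvd_mul_left g f))
    exfalso
    obtain ⟨p, q, rfl⟩ := exists_eq_X_add_C_of_natDegree_le_one (show f.natDegree ≤ 1 by omega)
    obtain ⟨r, s, rfl⟩ := exists_eq_X_add_C_of_natDegree_le_one (show g.natDegree ≤ 1 by omega)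
    have hexp : C a * X ^ 2 + C b * X + C c =
        C (p * r) * X ^ 2 + C (p * s + q * r) * X + C (q * s) := by
      rw [hfg]
      simp only [map_mul, map_add]
      ring
    refine hfac p q r s ?_ ?_ ?_
    · simpa [coeff_X, coeff_C, -map_mul] using congrArg (coeff · 2) hexp
    · simpa [coeff_X, coeff_C, -map_mul] using congrArg (coeff · 0) hexp
    · simpa [coeff_X, coeff_C, -map_mul] using congrArg (coeff · 1) hexp

end Polynomial

theorem MvPolynomial.optionEquivLeft_rename_some {σ R : Type*} [CommSemiring R]
    (f : MvPolynomial σ R) : optionEquivLeft R σ (rename some f) = Polynomial.C f := by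
  induction f using MvPolynomial.induction_on with
  | C r => simp
  | add f g hf hg => simp [hf, hg]
  | mul_X f i hf => simp [hf]

/-- Let `K` be algebraically closed, `m ≥ 2`, and `a, b, c ∈ K[X_2, …, X_m]` (a ring in
`m - 1` variables) nonzero (for `a`, `b`) with no non-constant common factor. If there is a
point `Q ∈ K^{m-1}` with `m_Q (a c)` odd and `2 m_Q b > m_Q (a c)`, then
`p = a X_1 ^ 2 + b X_1 + c` is irreducible in `K[X_1, X_2, …, X_m]` (the variable `X_1`
being modelled by `none` in `Option (Fin (m - 1))`). -/
theorem stmt_9 (K : Type*) [Field K] [IsAlgClosed K] (m : ℕ) (hm : 2 ≤ m)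
    (a b c : MvPolynomial (Fin (m - 1)) K) (ha : a ≠ 0) (hb : b ≠ 0)
    (hcoprime : ∀ d : MvPolynomial (Fin (m - 1)) K,
      d ∣ a → d ∣ b → d ∣ c → d.totalDegree = 0)
    (Q : Fin (m - 1) → K) (hodd : Odd (multAt Q (a * c)))
    (hineq : multAt Q (a * c) < 2 * multAt Q b) :
    Irreducible
      ((rename some a) * X none ^ 2 + (rename some b) * X none + rename some c
        : MvPolynomial (Option (Fin (m - 1))) K) := by
  rw [← MulEquiv.irreducible_iff (optionEquivLeft K (Fin (m - 1)))]
  simp only [map_add, map_mul, map_pow, optionEquivLeft_rename_some, optionEquivLeft_X_none]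
  refine Polynomial.irreducible_quadratic_of_forall_ne ha (fun d hda hdb hdc => ?_) ?_
  · have hd := totalDegree_eq_zero_iff_eq_C.1 (hcoprime d hda hdb hdc)
    rw [hd]
    refine (IsUnit.mk0 _ fun h0 => ne_zero_of_dvd_ne_zero ha hda ?_).map C
    rw [hd, h0, C_0]
  · rintro p q r s rfl rfl rfl
    have hprod : p * r * (q * s) = p * s * (q * r) := by ring
    rw [hprod] at hodd hineq
    exact hineq.not_gt (multAt.two_mul_add_lt_of_odd_mul Q hodd)
end

section
/- Let q be a prime power, let α ∈ F_{q^6} ∖ {0} and β := α^{1+q^2+q^4} ∈ F_{q^2}, and let ξ be a generator of a normal basis {ξ, ξ^q, …, ξ^{q^5}} of F_{q^6} over F_q. With a, b, c the polynomials in X_2, X_3, X_4, X_5 defined by a := (1−β)X_3^2X_5 + (β+β^q−1)X_3X_4X_5 + (β−β^q)X_3X_5^2 − βX_4X_5^2 − X_3^2X_4 + X_3X_4^2 + [βX_3^2 − (β+β^q−1)X_3X_4 + (β−β^q+1)(X_4−X_3)X_5 + β^qX_5^2 − X_4^2]·X_2 + β^q(X_4−X_5)·X_2^2, b := X_5[(β−β^q+1)(X_3−X_5)X_3X_4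 − (β+β^q+1)X_3X_4^2 + βX_4^2X_5 + (β^q−1)X_3^2X_5] + (X_5−X_4)[(β−β^q−1)(X_3^2+X_4X_5) − (β+β^q−1)(X_4+X_5)X_3]·X_2 + [(β−β^q−1)(X_3−X_5)X_4 + (β+β^q+1)X_3X_5 − (β^q−1)X_4^2 − βX_3^2]·X_2^2, and c := β^qX_3^2X_4X_5(X_4−X_5) + [(β−β^q+1)(X_4−X_3)X_3X_4X_5 + (β+β^q−1)X_3X_4X_5^2 − βX_4^2X_5^2 − β^qX_3^2X_4^2 + X_3^2X_5^2]·X_2 + [βX_3^2X_4 − (β−β^q)X_3X_4^2 − (β+β^q−1)X_3X_4X_5 + βX_4^2X_5 − X_3X_5^2 − X_4^2X_5 + X_4X_5^2]·X_2^2, the point Q = (0, ξ, ξ^q, 0) is a zero of multiplicity exactly 1 (a simple zero) of c, is a zero of b, and is not a zero of a. -/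
open MvPolynomial

/-- The polynomial `a` (coefficient of `X_1 ^ 2`), in the variables
`X_2 = X 0`, `X_3 = X 1`, `X_4 = X 2`, `X_5 = X 3`, with `β`, `βq = β ^ q`. -/
noncomputable def polyA (K : Type*) [CommRing K] (β βq : K) : MvPolynomial (Fin 4) K :=
  let X2 : MvPolynomial (Fin 4) K := X 0
  let X3 : MvPolynomial (Fin 4) K := X 1
  let X4 : MvPolynomial (Fin 4) K := X 2
  let X5 : MvPolynomial (Fin 4) K := X 3
  C (1 - β) * X3 ^ 2 * X5 + C (β + βq - 1) * X3 * X4 * X5 + C (β - βq) * X3 * X5 ^ 2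
    - C β * X4 * X5 ^ 2 - X3 ^ 2 * X4 + X3 * X4 ^ 2
    + (C β * X3 ^ 2 - C (β + βq - 1) * X3 * X4 + C (β - βq + 1) * (X4 - X3) * X5
        + C βq * X5 ^ 2 - X4 ^ 2) * X2
    + C βq * (X4 - X5) * X2 ^ 2

/-- The polynomial `b` (coefficient of `X_1`). -/
noncomputable def polyB (K : Type*) [CommRing K] (β βq : K) : MvPolynomial (Fin 4) K :=
  let X2 : MvPolynomial (Fin 4) K := X 0
  let X3 : MvPolynomial (Fin 4) K := X 1
  let X4 : MvPolynomial (Fin 4) K := X 2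
  let X5 : MvPolynomial (Fin 4) K := X 3
  X5 * (C (β - βq + 1) * (X3 - X5) * X3 * X4 - C (β + βq + 1) * X3 * X4 ^ 2
      + C β * X4 ^ 2 * X5 + C (βq - 1) * X3 ^ 2 * X5)
    + (X5 - X4) * (C (β - βq - 1) * (X3 ^ 2 + X4 * X5)
        - C (β + βq - 1) * (X4 + X5) * X3) * X2
    + (C (β - βq - 1) * (X3 - X5) * X4 + C (β + βq + 1) * X3 * X5
        - C (βq - 1) * X4 ^ 2 - C β * X3 ^ 2) * X2 ^ 2

/-- The polynomial `c` (constant coefficient in `X_1`). -/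
noncomputable def polyC (K : Type*) [CommRing K] (β βq : K) : MvPolynomial (Fin 4) K :=
  let X2 : MvPolynomial (Fin 4) K := X 0
  let X3 : MvPolynomial (Fin 4) K := X 1
  let X4 : MvPolynomial (Fin 4) K := X 2
  let X5 : MvPolynomial (Fin 4) K := X 3
  C βq * X3 ^ 2 * X4 * X5 * (X4 - X5)
    + (C (β - βq + 1) * (X4 - X3) * X3 * X4 * X5 + C (β + βq - 1) * X3 * X4 * X5 ^ 2
        - C β * X4 ^ 2 * X5 ^ 2 - C βq * X3 ^ 2 * X4 ^ 2 + X3 ^ 2 * X5 ^ 2) * X2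
    + (C β * X3 ^ 2 * X4 - C (β - βq) * X3 * X4 ^ 2 - C (β + βq - 1) * X3 * X4 * X5
        + C β * X4 ^ 2 * X5 - X3 * X5 ^ 2 - X4 ^ 2 * X5 + X4 * X5 ^ 2) * X2 ^ 2

/-- Partial differentiation commutes with translation. -/
theorem pderiv_bind₁_X_add_C {σ K : Type*} [CommSemiring K] (Q : σ → K) (i : σ)
    (f : MvPolynomial σ K) :
    pderiv i (bind₁ (fun j => X j + C (Q j)) f) =
      bind₁ (fun j => X j + C (Q j)) (pderiv i f) := by
  classical
  induction f using MvPolynomial.induction_on with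
  | C a => simp
  | add f g hf hg => simp [hf, hg]
  | mul_X f j hf =>
    rw [map_mul, pderiv_mul, hf, pderiv_mul, map_add, map_mul, map_mul, bind₁_X_right,
      map_add, pderiv_C, add_zero, pderiv_X]
    by_cases h : i = j
    · subst h; simp
    · simp [Ne.symm h]

/-- The constant coefficient of the translate `f (X + Q)` is the value of `f` at `Q`. -/
theorem coeff_zero_bind₁_X_add_C {σ K : Type*} [CommSemiring K] (Q : σ → K)
    (f : MvPolynomial σ K) :
    coeff 0 (bind₁ (fun j => X j + C (Q j)) f) = eval Q f := by
  induction f using MvPolynomial.induction_on with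
  | C a => simp
  | add f g hf hg => simp [hf, hg]
  | mul_X f j hf =>
    rw [← constantCoeff_eq] at hf ⊢
    simp [hf]

/-- A zero of `f` at which some partial derivative does not vanish has multiplicity one. -/
theorem multAt_eq_one {σ K : Type*} [CommSemiring K] {Q : σ → K} {f : MvPolynomial σ K}
    (i : σ) (h0 : eval Q f = 0) (h1 : eval Q (pderiv i f) ≠ 0) : multAt Q f = 1 := by
  refine IsLeast.csInf_eq ⟨fun h => h1 ?_, fun k hk => ?_⟩
  · rw [← coeff_zero_bind₁_X_add_C, ← pderiv_bind₁_X_add_C, coeff_pderiv]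
    have := congrArg (coeff (Finsupp.single i 1)) h
    rw [coeff_homogeneousComponent] at this
    simpa using this
  · refine Nat.one_le_iff_ne_zero.mpr fun hk0 => hk ?_
    rw [hk0, homogeneousComponent_zero, coeff_zero_bind₁_X_add_C, h0, C_0]

/-- Let `q = p ^ e` be a prime power, and work inside an algebraically closed field `K` of
characteristic `p`, in which `F_{q^6}` is the set of fixed points of `z ↦ z ^ q ^ 6` and
`F_q` the set of fixed points of `z ↦ z ^ q`. Let `α ∈ F_{q^6} \ {0}`,
`β = α ^ (1 + q ^ 2 + q ^ 4)`, and let `ξ` generate a normal basis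
`{ξ, ξ^q, …, ξ^{q^5}}` of `F_{q^6}` over `F_q` (expressed by linear independence and
spanning over `F_q`). Then `Q = (0, ξ, ξ^q, 0)` is a simple zero (multiplicity exactly `1`)
of `c`, a zero of `b`, and not a zero of `a`. -/
theorem stmt_11 (p e : ℕ) (hp : p.Prime) (he : 0 < e) (q : ℕ) (hq : q = p ^ e)
    (K : Type*) [Field K] [IsAlgClosed K] [CharP K p]
    (α : K) (hα0 : α ≠ 0) (hα : α ^ q ^ 6 = α)
    (ξ : K) (hξ : ξ ^ q ^ 6 = ξ)
    (hindep : ∀ cf : Fin 6 → K, (∀ i, cf i ^ q = cf i) →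
      ∑ i : Fin 6, cf i * ξ ^ q ^ (i : ℕ) = 0 → ∀ i, cf i = 0)
    (hspan : ∀ x : K, x ^ q ^ 6 = x →
      ∃ cf : Fin 6 → K, (∀ i, cf i ^ q = cf i) ∧
        x = ∑ i : Fin 6, cf i * ξ ^ q ^ (i : ℕ)) :
    multAt ![0, ξ, ξ ^ q, 0]
        (polyC K (α ^ (1 + q ^ 2 + q ^ 4)) ((α ^ (1 + q ^ 2 + q ^ 4)) ^ q)) = 1 ∧
    eval ![0, ξ, ξ ^ q, 0]
        (polyB K (α ^ (1 + q ^ 2 + q ^ 4)) ((α ^ (1 + q ^ 2 + q ^ 4)) ^ q)) = 0 ∧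
    eval ![0, ξ, ξ ^ q, 0]
        (polyA K (α ^ (1 + q ^ 2 + q ^ 4)) ((α ^ (1 + q ^ 2 + q ^ 4)) ^ q)) ≠ 0 := by
  have hne : ξ ^ q ≠ ξ := fun h => by
    have := hindep ![1, -1, 0, 0, 0, 0] ?_ ?_ 0
    · simp at this
    · have hq0 : q ≠ 0 := hq ▸ (pow_pos hp.pos e).ne'
      have : Fact p.Prime := ⟨hp⟩
      have hneg : (-1 : K) ^ q = -1 := by
        rw [hq, neg_pow, one_pow, mul_one, neg_one_pow_expChar_pow]
      intro i
      fin_cases i <;> simp [hq0, hneg]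
    · simp [Fin.sum_univ_succ, h]
  have hξ0 : ξ ≠ 0 := fun h => by
    have hq0 : q ≠ 0 := hq ▸ (pow_pos hp.pos e).ne'
    exact hne (by simp [h, hq0])
  have hβ : (α ^ (1 + q ^ 2 + q ^ 4)) ^ q ≠ 0 := pow_ne_zero _ (pow_ne_zero _ hα0)
  refine ⟨multAt_eq_one 3 ?_ ?_, ?_, ?_⟩
  · simp [polyC]
  · have h : eval ![0, ξ, ξ ^ q, 0] (pderiv 3
        (polyC K (α ^ (1 + q ^ 2 + q ^ 4)) ((α ^ (1 + q ^ 2 + q ^ 4)) ^ q))) =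
        (α ^ (1 + q ^ 2 + q ^ 4)) ^ q * ξ ^ 2 * ξ ^ q * ξ ^ q := by
      generalize (α ^ (1 + q ^ 2 + q ^ 4)) ^ q = βq
      generalize α ^ (1 + q ^ 2 + q ^ 4) = β
      simp [polyC]
      ring
    rw [h]
    exact mul_ne_zero (mul_ne_zero (mul_ne_zero hβ (pow_ne_zero _ hξ0)) (pow_ne_zero _ hξ0))
      (pow_ne_zero _ hξ0)
  · simp [polyB]
  · have h : eval ![0, ξ, ξ ^ q, 0]
        (polyA K (α ^ (1 + q ^ 2 + q ^ 4)) ((α ^ (1 + q ^ 2 + q ^ 4)) ^ q)) =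
        ξ * ξ ^ q * (ξ ^ q - ξ) := by
      simp [polyA]
      ring
    rw [h]
    exact mul_ne_zero (mul_ne_zero hξ0 (pow_ne_zero _ hξ0)) (sub_ne_zero.mpr hne)
end

section
/- Let q be an odd prime power and let β ∈ F_{q^4} ∖ {0}. If β^{q^3 + q^2 + q − 1} = 1, then β = 1 or β = −1. -/
/-- Let `q = p ^ e` be an odd prime power and `β` a nonzero element of the field `F_{q^4}`
with `q ^ 4` elements. If `β ^ (q ^ 3 + q ^ 2 + q - 1) = 1`, then `β = 1` or `β = -1`. -/
theorem stmt_17 (p e : ℕ) (hp : p.Prime) (hpodd : Odd p) (he : 0 < e) (q : ℕ)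
    (hq : q = p ^ e)
    (F : Type*) [Field F] [Fintype F] (hcard : Fintype.card F = q ^ 4)
    (β : F) (hβ : β ≠ 0) (h : β ^ (q ^ 3 + q ^ 2 + q - 1) = 1) :
    β = 1 ∨ β = -1 := by
  obtain ⟨k, hk⟩ : Odd q := hq ▸ hpodd.pow
  have hN : q ^ 3 + q ^ 2 + q - 1 = 4 * k * (2 * k ^ 2 + 4 * k + 3) + 2 := by
    rw [hk]
    apply Nat.sub_eq_of_eq_add
    ring
  have hcard_sub : q ^ 4 - 1 = (q ^ 3 + q ^ 2 + q - 1) * (2 * k) + 4 * k := by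
    rw [hN, hk]
    apply Nat.sub_eq_of_eq_add
    ring
  have h4k : β ^ (4 * k) = 1 := by
    have hF := FiniteField.pow_card_sub_one_eq_one β hβ
    rwa [hcard, hcard_sub, pow_add, pow_mul, h, one_pow, one_mul] at hF
  rw [hN, pow_add, pow_mul, h4k, one_pow, one_mul] at h
  simpa using h
end
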